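/- Let f : S³ → (0, ∞) be a smooth function on the unit sphere S³ ⊂ ℝ⁴ and let S := {√(f(p))·p : p ∈ S³}. Then there exist T with 0 < T ≤ π·max_{p∈S³} f(p) and a nonconstant smooth map γ : ℝ → ℝ⁴ with image in S such that for all t ∈ ℝ one has γ(t + T) = γ(t), γ′(t) ∈ T_{γ(t)}S, ω_st(γ′(t), v) = 0 for all v ∈ T_{γ(t)}S, and λ_st(γ(t))(γ′(t)) = 1. In other words, the infimum of the periods of closed (automatically contractible, since S is diffeomorphic to S³) Reeb orbits of λ_st|TS is at most π·max f. -/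

import Mathlib

noncomputable section

open scoped RealInnerProductSpace ContDiff
open Real

/-- ℝ⁴ with the Euclidean inner product. -/
abbrev R4 : Type := EuclideanSpace ℝ (Fin 4)

/-- The standard symplectic form ω_st = dx₁∧dy₁ + dx₂∧dy₂ on ℝ⁴. -/
def omegaSt (u v : R4) : ℝ := u 0 * v 1 - u 1 * v 0 + u 2 * v 3 - u 3 * v 2

/-- The standard Liouville 1-form λ_st(x)(u) = ½ ω_st(x,u). -/
def lambdaSt (x u : R4) : ℝ := (1 / 2) * omegaSt x u

section Brouwer

open MeasureTheory Set Metric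
open scoped NNReal

variable {E : Type*} [NormedAddCommGroup E]

theorem bijective_id_add_of_lipschitz [CompleteSpace E] {v : E → E} {K : ℝ≥0}
    (hv : LipschitzWith K v) (hK : K < 1) : Function.Bijective (fun x => x + v x) := by
  constructor
  · intro x y hxy
    have h1 : x - y = v y - v x := by
      have : x + v x = y + v y := hxy
      rw [sub_eq_sub_iff_add_eq_add, this, add_comm]
    have h2 := hv.dist_le_mul x y
    rw [dist_eq_norm, dist_eq_norm, norm_sub_rev (v x), ← h1] at h2
    have h3 : (K : ℝ) < 1 := by exact_mod_cast hK
    have h4 : ‖x - y‖ = 0 := by nlinarith [norm_nonneg (x - y)]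
    exact sub_eq_zero.1 (norm_eq_zero.1 h4)
  · intro y
    have hc : ContractingWith K (fun x => y - v x) :=
      ⟨hK, LipschitzWith.of_dist_le_mul fun a b => by
        rw [dist_sub_left]; exact hv.dist_le_mul a b⟩
    refine ⟨hc.fixedPoint, ?_⟩
    have h : y - v hc.fixedPoint = hc.fixedPoint := hc.fixedPoint_isFixedPt
    change hc.fixedPoint + v hc.fixedPoint = y
    rw [← sub_eq_iff_eq_add.1 h]

variable [NormedSpace ℝ E]

/-- A Lipschitz map on a closed ball vanishing on the sphere extends by zero to a Lipschitz map. -/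
theorem LipschitzOnWith.indicator_closedBall {v : E → E} {K : ℝ≥0} {R : ℝ}
    (hv : LipschitzOnWith K v (closedBall 0 R)) (h0 : ∀ x, ‖x‖ = R → v x = 0) :
    LipschitzWith K ((closedBall (0 : E) R).indicator v) := by
  have key : ∀ x y : E, ‖x‖ ≤ R → R < ‖y‖ → ‖v x‖ ≤ K * ‖x - y‖ := by
    intro x y hx hy
    have hcont : ContinuousOn (fun t : ℝ => ‖x + t • (y - x)‖) (Icc 0 1) := by fun_prop
    obtain ⟨t, ht, htR⟩ := intermediate_value_Icc (zero_le_one' ℝ) hcont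
      (show R ∈ Icc _ _ by simpa using ⟨hx, hy.le⟩)
    have htR' : ‖x + t • (y - x)‖ = R := htR
    have h1 := hv.dist_le_mul x (by simpa using hx) (x + t • (y - x)) (by simpa using htR'.le)
    rw [h0 _ htR', dist_zero_right, dist_eq_norm] at h1
    refine h1.trans (mul_le_mul_of_nonneg_left ?_ K.2)
    rw [sub_add_cancel_left, norm_neg, norm_smul, norm_sub_rev y x, Real.norm_of_nonneg ht.1]
    exact mul_le_of_le_one_left (norm_nonneg _) ht.2
  refine LipschitzWith.of_dist_le_mul fun x y => ?_
  by_cases hx : ‖x‖ ≤ R <;> by_cases hy : ‖y‖ ≤ R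
  · rw [indicator_of_mem (by simpa using hx), indicator_of_mem (by simpa using hy)]
    exact hv.dist_le_mul x (by simpa using hx) y (by simpa using hy)
  · rw [indicator_of_mem (by simpa using hx), indicator_of_notMem (by simpa using hy),
      dist_zero_right, dist_eq_norm]
    exact key x y hx (not_le.1 hy)
  · rw [indicator_of_notMem (by simpa using hx), indicator_of_mem (by simpa using hy),
      dist_zero_left, dist_eq_norm, norm_sub_rev]
    exact key y x hy (not_le.1 hx)
  · rw [indicator_of_notMem (by simpa using hx), indicator_of_notMem (by simpa using hy), dist_self]
    positivity

variable [FiniteDimensional ℝ E]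

theorem det_one_add_pos_of_norm_lt_one {M : E →L[ℝ] E} (hM : ‖M‖ < 1) :
    0 < (1 + M : E →L[ℝ] E).det := by
  have hne : ∀ s ∈ Icc (0 : ℝ) 1, (1 + s • M : E →L[ℝ] E).det ≠ 0 := by
    intro s hs h
    have hlt : ‖-(s • M)‖ < 1 := by
      rw [norm_neg, norm_smul, Real.norm_of_nonneg hs.1]
      exact (mul_le_of_le_one_left (norm_nonneg _) hs.2).trans_lt hM
    have hu : IsUnit (1 - -(s • M)) := isUnit_one_sub_of_norm_lt_one hlt
    rw [sub_neg_eq_add] at hu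
    have := hu.map (ContinuousLinearMap.toLinearMapRingHom (R₁ := ℝ) (M₁ := E))
    have h2 := (LinearMap.isUnit_iff_isUnit_det _).1 this
    exact h2.ne_zero h
  have hcont : ContinuousOn (fun s : ℝ => (1 + s • M : E →L[ℝ] E).det) (Icc 0 1) :=
    (ContinuousLinearMap.continuous_det.comp (by fun_prop)).continuousOn
  by_contra hneg
  rw [not_lt] at hneg
  obtain ⟨s, hs, h⟩ := intermediate_value_Icc' (zero_le_one' ℝ) hcont
    (show (0 : ℝ) ∈ Icc _ _ by
      refine ⟨by simpa using hneg, ?_⟩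
      simp [ContinuousLinearMap.det])
  exact hne s hs h

/-- Along a line through the identity, the determinant is a polynomial of degree at most the
dimension, so that its value at `1` is a fixed combination of values at interpolation nodes. -/
theorem det_one_add_eq_sum_lagrange {v : ℕ → ℝ} (hv : Function.Injective v) (M : E →L[ℝ] E) :
    (1 + M : E →L[ℝ] E).det = ∑ i ∈ Finset.range (Module.finrank ℝ E + 1),
      (1 + v i • M : E →L[ℝ] E).det *
        (Lagrange.basis (Finset.range (Module.finrank ℝ E + 1)) v i).eval 1 := by
  classical
  let b := Module.finBasis ℝ E
  let A := LinearMap.toMatrix b b (M : E →ₗ[ℝ] E)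
  let P : Polynomial ℝ :=
    ((Polynomial.X : Polynomial ℝ) • A.map Polynomial.C + (1 : Matrix _ _ ℝ).map Polynomial.C).det
  have hP : ∀ t : ℝ, P.eval t = (1 + t • M : E →L[ℝ] E).det := by
    intro t
    have h1 : P.eval t = (t • A + 1).det := by
      simp only [P]
      rw [← Polynomial.coe_evalRingHom, RingHom.map_det]
      congr 1
      ext i j
      by_cases h : i = j <;> simp [Matrix.add_apply, h] <;> ring
    rw [h1, ContinuousLinearMap.det, ← LinearMap.det_toMatrix b]
    congr 1
    simp only [A, ContinuousLinearMap.toLinearMap_add, ContinuousLinearMap.toLinearMap_smul,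
      map_add, map_smul]
    rw [add_comm]
    congr 1
    exact (LinearMap.toMatrix_id b).symm
  have hdeg : P.degree < (Finset.range (Module.finrank ℝ E + 1)).card := by
    refine Polynomial.degree_le_natDegree.trans_lt ?_
    rw [Finset.card_range]
    have := Polynomial.natDegree_det_X_add_C_le A 1
    rw [Fintype.card_fin] at this
    exact_mod_cast Nat.lt_succ_of_le this
  have := Lagrange.eq_interpolate_of_eval_eq (v := v)
    (fun i => (1 + v i • M : E →L[ℝ] E).det) (hv.injOn) hdeg (fun i _ => hP (v i))
  have h1 := hP 1
  rw [one_smul] at h1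
  rw [← h1, this, Lagrange.interpolate_apply, Polynomial.eval_finsetSum]
  simp

/-- The integral of the Jacobian of a Lipschitz perturbation of the identity supported in a ball
is the volume of the ball. -/
theorem setIntegral_det_one_add_fderiv [MeasurableSpace E] [BorelSpace E] (μ : Measure E)
    [μ.IsAddHaarMeasure] {v : E → E} {K : ℝ≥0} {R : ℝ} (hv : LipschitzWith K v)
    (hd : ∀ x ∈ ball (0 : E) R, DifferentiableAt ℝ v x) (h0 : ∀ x, R ≤ ‖x‖ → v x = 0) :
    ∫ x in ball (0 : E) R, (1 + fderiv ℝ v x : E →L[ℝ] E).det ∂μ = μ.real (ball (0 : E) R) := by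
  have small : ∀ t : ℝ, 0 ≤ t → t * K < 1 →
      IntegrableOn (fun x => (1 + t • fderiv ℝ v x : E →L[ℝ] E).det) (ball 0 R) μ ∧
      ∫ x in ball (0 : E) R, (1 + t • fderiv ℝ v x : E →L[ℝ] E).det ∂μ
        = μ.real (ball (0 : E) R) := by
    intro t ht htK
    have hpos : ∀ x ∈ ball (0 : E) R, 0 < (1 + t • fderiv ℝ v x : E →L[ℝ] E).det := by
      intro x hx
      refine det_one_add_pos_of_norm_lt_one ?_
      rw [norm_smul, Real.norm_of_nonneg ht]
      exact (mul_le_mul_of_nonneg_left ((hd x hx).hasFDerivAt.le_of_lipschitz hv) ht).trans_lt htK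
    have hlip : LipschitzWith (t.toNNReal * K) (fun x => t • v x) := by
      refine LipschitzWith.of_dist_le_mul fun x y => ?_
      rw [dist_smul₀, Real.norm_of_nonneg ht, NNReal.coe_mul, Real.coe_toNNReal t ht, mul_assoc]
      exact mul_le_mul_of_nonneg_left (hv.dist_le_mul x y) ht
    have hbij := bijective_id_add_of_lipschitz hlip (by
      rw [← NNReal.coe_lt_coe]; simpa [Real.coe_toNNReal t ht] using htK)
    have himg : (fun x => x + t • v x) '' ball (0 : E) R = ball 0 R := by
      have hc : (fun x => x + t • v x) '' (ball (0 : E) R)ᶜ = (ball 0 R)ᶜ := by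
        conv_rhs => rw [← image_id (ball (0 : E) R)ᶜ]
        refine image_congr fun x hx => ?_
        have hx' : R ≤ ‖x‖ := by simpa using hx
        simp [h0 x hx']
      rw [image_compl_eq hbij] at hc
      exact compl_injective hc
    have hlin := lintegral_abs_det_fderiv_eq_addHaar_image μ (s := ball (0 : E) R)
      (f := fun x => x + t • v x) (f' := fun x => 1 + t • fderiv ℝ v x) measurableSet_ball
      (fun x hx => ((hasFDerivAt_id x).add ((hd x hx).hasFDerivAt.const_smul t)).hasFDerivWithinAt)
      hbij.1.injOn
    rw [himg] at hlin
    have hmeas : Measurable (fun x => (1 + t • fderiv ℝ v x : E →L[ℝ] E).det) :=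
      ContinuousLinearMap.continuous_det.measurable.comp
        (((measurable_fderiv ℝ v).const_smul t).const_add 1)
    have hae : 0 ≤ᵐ[μ.restrict (ball (0 : E) R)]
        (fun x => (1 + t • fderiv ℝ v x : E →L[ℝ] E).det) :=
      (ae_restrict_mem measurableSet_ball).mono fun x hx => (hpos x hx).le
    have hlin' : ∫⁻ x in ball (0 : E) R, ENNReal.ofReal (1 + t • fderiv ℝ v x : E →L[ℝ] E).det ∂μ
        = μ (ball 0 R) := by
      rw [← hlin]
      exact setLIntegral_congr_fun measurableSet_ball fun x hx => by
        rw [abs_of_pos (hpos x hx)]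
    refine ⟨⟨hmeas.aestronglyMeasurable, ?_⟩, ?_⟩
    · rw [hasFiniteIntegral_iff_ofReal hae, hlin']
      exact measure_ball_lt_top
    · rw [integral_eq_lintegral_of_nonneg_ae hae hmeas.aestronglyMeasurable, hlin']
      rfl
  let τ : ℕ → ℝ := fun i => ((i + 1 : ℝ) * (K + 1))⁻¹
  have hτ0 : ∀ i, 0 ≤ τ i := fun i => by positivity
  have hτK : ∀ i, τ i * K < 1 := by
    intro i
    have hi : (0 : ℝ) ≤ i := i.cast_nonneg
    have hK : (0 : ℝ) ≤ K := K.2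
    simp only [τ]
    rw [inv_mul_lt_one₀ (by positivity)]
    nlinarith
  have hτ : Function.Injective τ := by
    intro i j hij
    have hK : (K + 1 : ℝ) ≠ 0 := by positivity
    have := mul_right_cancel₀ hK (inv_injective hij)
    exact_mod_cast add_right_cancel this
  have hsum1 : ∑ i ∈ Finset.range (Module.finrank ℝ E + 1),
      (Lagrange.basis (Finset.range (Module.finrank ℝ E + 1)) τ i).eval 1 = 1 := by
    rw [← Polynomial.eval_finsetSum, Lagrange.sum_basis hτ.injOn ⟨0, by simp⟩, Polynomial.eval_one]
  rw [integral_congr_ae (.of_forall fun x => det_one_add_eq_sum_lagrange hτ (fderiv ℝ v x))]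
  rw [integral_finsetSum _ fun i _ => ((small _ (hτ0 i) (hτK i)).1.mul_const _)]
  simp_rw [integral_mul_const, (small _ (hτ0 _) (hτK _)).2, ← Finset.mul_sum, hsum1, mul_one]

end Brouwer

section BrouwerInner

open MeasureTheory Set Metric
open scoped NNReal

variable {E : Type*} [NormedAddCommGroup E] [InnerProductSpace ℝ E] [FiniteDimensional ℝ E]

/-- There is no smooth retraction of a ball onto its boundary sphere. -/
theorem no_smooth_retraction {r : E → E} {R : ℝ} (hR : 0 < R) (hr : ContDiff ℝ 1 r)
    (hnorm : ∀ x, ‖r x‖ = R) (hid : ∀ x, ‖x‖ = R → r x = x) : False := by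
  borelize E
  let μ : Measure E := Measure.addHaar
  obtain ⟨K, hK⟩ := (hr.sub contDiff_id).contDiffOn.exists_lipschitzOnWith one_ne_zero
    (convex_closedBall (0 : E) R) (isCompact_closedBall 0 R)
  let v : E → E := (closedBall (0 : E) R).indicator fun x => r x - x
  have hv : LipschitzWith K v :=
    LipschitzOnWith.indicator_closedBall hK fun x hx => by simp [hid x hx]
  have hev : ∀ x ∈ ball (0 : E) R, v =ᶠ[nhds x] fun x => r x - x := by
    intro x hx
    filter_upwards [isOpen_ball.mem_nhds hx] with y hy
    exact indicator_of_mem (ball_subset_closedBall hy) _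
  have hd' : ∀ x ∈ ball (0 : E) R, HasFDerivAt v (fderiv ℝ r x - 1) x := fun x hx =>
    (((hr.differentiable one_ne_zero x).hasFDerivAt.sub (hasFDerivAt_id x))).congr_of_eventuallyEq
      (hev x hx)
  have hint := setIntegral_det_one_add_fderiv μ hv (R := R)
    (fun x hx => (hd' x hx).differentiableAt)
    (fun x hx => by
      rcases hx.eq_or_lt with h | h
      · simp only [v]
        rw [indicator_of_mem (by simp [h]), hid x h.symm, sub_self]
      · exact indicator_of_notMem (by simpa using h) _)
  have hdet : ∀ x ∈ ball (0 : E) R, (1 + fderiv ℝ v x : E →L[ℝ] E).det = 0 := by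
    intro x hx
    rw [(hd' x hx).fderiv, add_sub_cancel]
    by_contra hne
    have hu : IsUnit (LinearMap.det (fderiv ℝ r x : E →ₗ[ℝ] E)) := isUnit_iff_ne_zero.2 hne
    have hsurj : Function.Surjective (fderiv ℝ r x) :=
      ((Module.End.isUnit_iff _).1 ((LinearMap.isUnit_iff_isUnit_det _).2 hu)).2
    obtain ⟨w, hw⟩ := hsurj (r x)
    have hdiff := (hr.differentiable one_ne_zero x).hasFDerivAt
    have h1 : HasFDerivAt (fun y => ⟪r y, r y⟫) _ x := hdiff.inner ℝ hdiff
    have h2 : (fun y => ⟪r y, r y⟫) = fun _ => R ^ 2 := by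
      funext y; rw [real_inner_self_eq_norm_sq, hnorm]
    rw [h2] at h1
    have h3 := congrArg (fun L => L w) (h1.unique (hasFDerivAt_const (R ^ 2) x))
    simp [hw, hnorm, hR.ne'] at h3
  rw [setIntegral_congr_fun measurableSet_ball hdet, integral_zero] at hint
  have hpos : 0 < μ (ball (0 : E) R) := measure_ball_pos μ 0 hR
  have := (measureReal_eq_zero_iff (μ := μ) (s := ball (0 : E) R)
    measure_ball_lt_top.ne).1 hint.symm
  exact hpos.ne' this

/-- A continuous self-map of a closed ball which is the identity on the boundary has a zero. -/
theorem exists_zero_of_eq_id_on_sphere {g : E → E} (hg : ContinuousOn g (closedBall 0 1))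
    (hid : ∀ x, ‖x‖ = 1 → g x = x) : ∃ x, ‖x‖ ≤ 1 ∧ g x = 0 := by
  by_contra! hne
  let G : E → E := fun x => if ‖x‖ ≤ 1 then g x else x
  have hGc : Continuous G := by
    refine continuous_if_le continuous_norm continuous_const ?_ continuousOn_id ?_
    · exact hg.mono fun x hx => by simpa using hx
    · exact fun x hx => hid x hx
  obtain ⟨ε, hε, hGε⟩ : ∃ ε > 0, ∀ x, ε ≤ ‖G x‖ := by
    obtain ⟨x0, hx0, hmin⟩ := (isCompact_closedBall (0 : E) 1).exists_isMinOn ⟨0, by simp⟩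
      hGc.norm.continuousOn
    have hx0' : ‖x0‖ ≤ 1 := by simpa using hx0
    refine ⟨min ‖G x0‖ 1, lt_min ?_ one_pos, fun x => ?_⟩
    · simp only [G, if_pos hx0']
      exact norm_pos_iff.2 (hne x0 hx0')
    · by_cases hx : ‖x‖ ≤ 1
      · exact (min_le_left _ _).trans (hmin (show x ∈ closedBall (0 : E) 1 by simpa using hx))
      · simp only [G, if_neg hx]
        exact (min_le_right _ _).trans (not_le.1 hx).le
  obtain ⟨w, hw, hwd, hwS, -⟩ := hGc.exists_contDiff_approx_and_eqOn 1 (ε := fun _ => ε)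
    continuous_const (fun _ => hε) (S := (ball (0 : E) 2)ᶜ) (U := (closedBall (0 : E) 1)ᶜ)
    isOpen_ball.isClosed_compl
    (isClosed_closedBall.isOpen_compl.mem_nhdsSet.2
      (compl_subset_compl.2 (closedBall_subset_ball (by norm_num))))
    (contDiffOn_id.congr fun x hx => by
      have : ¬ ‖x‖ ≤ 1 := by simpa using hx
      simp [G, this])
  have hw0 : ∀ x, w x ≠ 0 := by
    intro x hx
    have := hwd x
    rw [hx, dist_zero_left] at this
    exact absurd (hGε x) (not_le.2 this)
  refine no_smooth_retraction (E := E) (R := 2) (r := fun x => (2 * ‖w x‖⁻¹) • w x) two_pos ?_ ?_ ?_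
  · exact (contDiff_const.mul ((hw.norm ℝ hw0).inv fun x => norm_ne_zero_iff.2 (hw0 x))).smul hw
  · intro x
    rw [norm_smul, norm_mul, norm_inv, norm_norm, mul_assoc,
      inv_mul_cancel₀ (norm_ne_zero_iff.2 (hw0 x))]
    norm_num
  · intro x hx
    have h1 : w x = x := by
      rw [hwS (by simp [hx])]
      simp [G, hx]
    simp [h1, hx]

end BrouwerInner

section Minimax

open Set Metric Filter Topology

variable {E : Type*} [NormedAddCommGroup E] [InnerProductSpace ℝ E]

/-- Continuous maps from the unit ball of `N` to the unit sphere which are the identity on the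
boundary. -/
def IsCap (N : Submodule ℝ E) (h : N → E) : Prop :=
  ContinuousOn h (closedBall 0 1) ∧ (∀ u, ‖u‖ ≤ 1 → ‖h u‖ = 1) ∧ ∀ u : N, ‖u‖ = 1 → h u = u

theorem isCap_half_sphere {N : Submodule ℝ E} {e : E} (he : e ∈ Nᗮ) (he1 : ‖e‖ = 1) :
    IsCap N (fun u => (u : E) + √(1 - ‖u‖ ^ 2) • e) := by
  refine ⟨by fun_prop, fun u hu => ?_, fun u hu => by simp [hu]⟩
  have horth : ⟪(u : E), √(1 - ‖u‖ ^ 2) • e⟫ = 0 := by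
    rw [inner_smul_right, (Submodule.mem_orthogonal N e).1 he u u.2, mul_zero]
  have h1 : 0 ≤ 1 - ‖u‖ ^ 2 := by nlinarith [norm_nonneg u]
  have h2 := norm_add_sq_eq_norm_sq_add_norm_sq_real horth
  rw [norm_smul, he1, Real.norm_of_nonneg (sqrt_nonneg _), mul_one, Real.mul_self_sqrt h1] at h2
  have h3 : ‖(u : E) + √(1 - ‖u‖ ^ 2) • e‖ ^ 2 = 1 := by
    rw [sq, h2, Submodule.coe_norm]; ring
  exact (pow_eq_one_iff_of_nonneg (norm_nonneg _) two_ne_zero).1 h3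

variable [FiniteDimensional ℝ E]

theorem IsCap.exists_mem_orthogonal {N : Submodule ℝ E} {h : N → E} (hh : IsCap N h) :
    ∃ u, ‖u‖ ≤ 1 ∧ h u ∈ Nᗮ := by
  obtain ⟨u, hu, h0⟩ := exists_zero_of_eq_id_on_sphere (E := N)
    (g := fun u => N.orthogonalProjectionOnto (h u))
    ((N.orthogonalProjectionOnto).continuous.comp_continuousOn hh.1) (fun u hu => by
      rw [hh.2.2 u hu]
      exact N.orthogonalProjectionOnto_mem_subspace_eq_self u)
  exact ⟨u, hu, N.orthogonalProjectionOnto_eq_zero_iff.1 h0⟩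

/-- A one-step descent deformation of the unit sphere for the quotient of two functions with
continuous gradients. -/
theorem exists_descent_map [Nontrivial E] {A G : E → ℝ} {A' G' : E → E} {L : ℝ}
    (hAc : Continuous A) (hGc : Continuous G) (hA'c : Continuous A') (hG'c : Continuous G')
    (hA : ∀ (s : ℝ) x, 0 ≤ s → A (s • x) = s ^ 2 * A x)
    (hG : ∀ (s : ℝ) x, 0 ≤ s → G (s • x) = s ^ 2 * G x)
    (hGpos : ∀ x, x ≠ 0 → 0 < G x)
    (hAq : ∀ x h, |A (x + h) - A x - ⟪A' x, h⟫| ≤ L * ‖h‖ ^ 2)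
    (hGq : ∀ x h, |G (x + h) - G x - ⟪G' x, h⟫| ≤ L * ‖h‖ ^ 2) :
    ∃ (η : E → E) (κ : ℝ), 0 < κ ∧ ContinuousOn η (sphere 0 1) ∧
      ∀ x ∈ sphere (0 : E) 1, ‖η x‖ = 1 ∧ (A x ≤ 0 → η x = x) ∧
        A (η x) / G (η x) ≤ A x / G x -
          κ * (max 0 (A x / G x) * ‖A' x - (A x / G x) • G' x‖ ^ 2) := by
  have hne : ∀ x ∈ sphere (0 : E) 1, x ≠ 0 := fun x hx h => by simp [h] at hx
  have hGs : ∀ x ∈ sphere (0 : E) 1, 0 < G x := fun x hx => hGpos x (hne x hx)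
  have hΨc : ContinuousOn (fun x => A x / G x) (sphere 0 1) :=
    hAc.continuousOn.div hGc.continuousOn fun x hx => (hGs x hx).ne'
  have hWc : ContinuousOn (fun x => A' x - (A x / G x) • G' x) (sphere 0 1) :=
    hA'c.continuousOn.sub (hΨc.smul hG'c.continuousOn)
  have hVc : ContinuousOn (fun x => max 0 (A x / G x) • (A' x - (A x / G x) • G' x))
      (sphere 0 1) := (continuousOn_const.sup hΨc).smul hWc
  have hcomp : IsCompact (sphere (0 : E) 1) := isCompact_sphere 0 1
  obtain ⟨p, hp⟩ := hcomp.exists_bound_of_continuousOn hΨc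
  obtain ⟨m, hm⟩ := hcomp.exists_bound_of_continuousOn hVc
  obtain ⟨M, hM⟩ := (isCompact_closedBall (0 : E) 2).exists_bound_of_continuousOn hGc.continuousOn
  obtain ⟨x1, hx1⟩ : (sphere (0 : E) 1).Nonempty := NormedSpace.sphere_nonempty.2 zero_le_one
  have hp0 : 0 ≤ p := (norm_nonneg _).trans (hp x1 hx1)
  have hm0 : 0 ≤ m := (norm_nonneg _).trans (hm x1 hx1)
  have hM0 : 0 < M := (hGs x1 hx1).trans_le
    ((le_abs_self _).trans (hM x1 (sphere_subset_closedBall.trans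
      (closedBall_subset_closedBall one_le_two) hx1)))
  have hL0 : 0 ≤ L := by
    have h := (abs_nonneg _).trans (hAq x1 x1)
    have hx1' : ‖x1‖ = 1 := by simpa using hx1
    simpa [hx1'] using h
  let τ : ℝ := (2 * (L * (1 + p) * p + m + 1))⁻¹
  have hden : 0 < L * (1 + p) * p + m + 1 := by positivity
  have hτ : 0 < τ := by positivity
  have hτ1 : τ * (L * (1 + p) * p + m + 1) = 1 / 2 := by
    simp only [τ]; field_simp
  have hτL : L * (1 + p) * (τ * p) ≤ 1 / 2 := by nlinarith
  have hτm : τ * m ≤ 1 / 2 := by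
    have : 0 ≤ L * (1 + p) * p := by positivity
    nlinarith
  let y : E → E := fun x => x - τ • (max 0 (A x / G x) • (A' x - (A x / G x) • G' x))
  have hyc : ContinuousOn y (sphere 0 1) := continuousOn_id.sub (hVc.const_smul τ)
  have hyn : ∀ x ∈ sphere (0 : E) 1, 1 / 2 ≤ ‖y x‖ ∧ ‖y x‖ ≤ 2 := by
    intro x hx
    have hx' : ‖x‖ = 1 := by simpa using hx
    have h1 : ‖τ • (max 0 (A x / G x) • (A' x - (A x / G x) • G' x))‖ ≤ 1 / 2 := by
      rw [norm_smul, Real.norm_of_nonneg hτ.le]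
      exact (mul_le_mul_of_nonneg_left (hm x hx) hτ.le).trans hτm
    have h2 := norm_sub_norm_le x (τ • (max 0 (A x / G x) • (A' x - (A x / G x) • G' x)))
    have h3 := norm_sub_le x (τ • (max 0 (A x / G x) • (A' x - (A x / G x) • G' x)))
    rw [hx'] at h2 h3
    constructor
    · exact le_trans (by linarith) h2
    · exact h3.trans (by linarith)
  have hyne : ∀ x ∈ sphere (0 : E) 1, ‖y x‖ ≠ 0 := fun x hx =>
    (lt_of_lt_of_le (by norm_num) (hyn x hx).1).ne'
  refine ⟨fun x => ‖y x‖⁻¹ • y x, τ / (2 * M), by positivity,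
    (hyc.norm.inv₀ hyne).smul hyc, fun x hx => ⟨?_, fun hAx => ?_, ?_⟩⟩
  · rw [norm_smul, norm_inv, norm_norm, inv_mul_cancel₀ (hyne x hx)]
  · have h0 : max 0 (A x / G x) = 0 :=
      max_eq_left (div_nonpos_of_nonpos_of_nonneg hAx (hGs x hx).le)
    have hx' : ‖x‖ = 1 := by simpa using hx
    have hyx : y x = x := by simp [y, h0]
    simp only [hyx, hx', inv_one, one_smul]
  · have hyx : y x ≠ 0 := norm_ne_zero_iff.1 (hyne x hx)
    have hGy := hGpos _ hyx
    have hGM : G (y x) ≤ M := (le_abs_self _).trans (hM _ (by simpa using (hyn x hx).2))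
    have hs := inv_nonneg.2 (norm_nonneg (y x))
    simp only [hA _ _ hs, hG _ _ hs]
    rw [mul_div_mul_left _ _ (pow_ne_zero 2 (inv_ne_zero (hyne x hx)))]
    set Ψ := A x / G x with hΨ
    set W := A' x - Ψ • G' x with hW
    set χ := max 0 Ψ with hχ
    have hχ0 : 0 ≤ χ := le_max_left _ _
    have hΨp : |Ψ| ≤ p := hp x hx
    have hχp : χ ≤ p := max_le hp0 ((le_abs_self _).trans hΨp)
    have hAΨ : A x = Ψ * G x := (div_mul_cancel₀ _ (hGs x hx).ne').symm
    have hyx' : y x = x + -(τ • (χ • W)) := sub_eq_add_neg _ _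
    have e1 := abs_le.1 (hAq x (-(τ • (χ • W))))
    have e2 := abs_le.1 (hGq x (-(τ • (χ • W))))
    rw [← hyx'] at e1 e2
    have hn : ‖-(τ • (χ • W))‖ ^ 2 = (τ * χ * ‖W‖) ^ 2 := by
      rw [norm_neg, norm_smul, norm_smul, Real.norm_of_nonneg hτ.le, Real.norm_of_nonneg hχ0]
      ring
    rw [hn] at e1 e2
    have e3 : -Ψ * (G (y x) - G x - ⟪G' x, -(τ • (χ • W))⟫) ≤ p * (L * (τ * χ * ‖W‖) ^ 2) := by
      refine (le_abs_self _).trans ?_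
      rw [abs_mul, abs_neg]
      exact mul_le_mul hΨp (abs_le.2 e2) (abs_nonneg _) hp0
    have e4 : ⟪A' x, -(τ • (χ • W))⟫ - Ψ * ⟪G' x, -(τ • (χ • W))⟫ = -(τ * χ * ‖W‖ ^ 2) := by
      rw [← real_inner_smul_left, ← inner_sub_left, ← hW, inner_neg_right, inner_smul_right,
        inner_smul_right, real_inner_self_eq_norm_sq]
      ring
    have e5 : A (y x) - Ψ * G (y x) ≤ -(τ * χ * ‖W‖ ^ 2) + L * (1 + p) * (τ * χ * ‖W‖) ^ 2 := by
      nlinarith [e1.2]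
    have e6 : L * (1 + p) * (τ * χ * ‖W‖) ^ 2 ≤ 1 / 2 * (τ * χ * ‖W‖ ^ 2) := by
      have h1 : L * (1 + p) * (τ * χ) ≤ 1 / 2 := by
        refine le_trans ?_ hτL
        gcongr
      have h2 : 0 ≤ τ * χ * ‖W‖ ^ 2 := by positivity
      nlinarith
    rw [div_le_iff₀ hGy]
    have e7 : τ / (2 * M) * (χ * ‖W‖ ^ 2) * G (y x) ≤ τ / (2 * M) * (χ * ‖W‖ ^ 2) * M := by
      gcongr
    have e8 : τ / (2 * M) * (χ * ‖W‖ ^ 2) * M = 1 / 2 * (τ * χ * ‖W‖ ^ 2) := by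
      field_simp
    linarith [sub_mul Ψ (τ / (2 * M) * (χ * ‖W‖ ^ 2)) (G (y x))]

/-- A linking theorem for the quotient of two functions homogeneous of degree two. -/
theorem exists_critical_quotient {A G : E → ℝ} {A' G' : E → E} {L a b : ℝ}
    (hAc : Continuous A) (hGc : Continuous G) (hA'c : Continuous A') (hG'c : Continuous G')
    (hA : ∀ (s : ℝ) x, 0 ≤ s → A (s • x) = s ^ 2 * A x)
    (hG : ∀ (s : ℝ) x, 0 ≤ s → G (s • x) = s ^ 2 * G x)
    (hGpos : ∀ x, x ≠ 0 → 0 < G x)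
    (hAq : ∀ x h, |A (x + h) - A x - ⟪A' x, h⟫| ≤ L * ‖h‖ ^ 2)
    (hGq : ∀ x h, |G (x + h) - G x - ⟪G' x, h⟫| ≤ L * ‖h‖ ^ 2)
    (N : Submodule ℝ E) {e : E} (he : e ∈ Nᗮ) (he1 : ‖e‖ = 1) (ha : 0 < a)
    (hN : ∀ x ∈ N, A x ≤ 0) (hNe : ∀ x ∈ N, ∀ s : ℝ, A (x + s • e) ≤ b * G (x + s • e))
    (hP : ∀ x ∈ Nᗮ, a * G x ≤ A x) :
    ∃ (x : E) (T : ℝ), ‖x‖ = 1 ∧ a ≤ T ∧ T ≤ b ∧ A' x = T • G' x := by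
  have : Nontrivial E := ⟨e, 0, fun h => by simp [h] at he1⟩
  obtain ⟨η, κ, hκ, hηc, hη⟩ := exists_descent_map hAc hGc hA'c hG'c hA hG hGpos hAq hGq
  have hne : ∀ x : E, ‖x‖ = 1 → x ≠ 0 := fun x hx h => by simp [h] at hx
  have hGs : ∀ x : E, ‖x‖ = 1 → 0 < G x := fun x hx => hGpos x (hne x hx)
  let Λ : Set ℝ := {l | ∃ h : N → E, IsCap N h ∧ ∀ u, ‖u‖ ≤ 1 → A (h u) / G (h u) ≤ l}
  have hΛa : ∀ l ∈ Λ, a ≤ l := by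
    rintro l ⟨h, hh, hl⟩
    obtain ⟨u, hu, hu'⟩ := hh.exists_mem_orthogonal
    refine le_trans ?_ (hl u hu)
    rw [le_div_iff₀ (hGs _ (hh.2.1 u hu))]
    exact hP _ hu'
  have hbdd : BddBelow Λ := ⟨a, hΛa⟩
  have hbΛ : b ∈ Λ := by
    refine ⟨_, isCap_half_sphere he he1, fun u hu => ?_⟩
    rw [div_le_iff₀ (hGs _ ((isCap_half_sphere he he1).2.1 u hu))]
    exact hNe _ u.2 _
  set c := sInf Λ with hc
  have hac : a ≤ c := le_csInf ⟨b, hbΛ⟩ hΛa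
  have hcb : c ≤ b := csInf_le hbdd hbΛ
  have hseq : ∀ j : ℕ, ∃ x : E, ‖x‖ = 1 ∧ A x / G x ≤ c + 1 / (j + 1) ∧
      c - 1 / (j + 1) ≤ A x / G x -
          κ * (max 0 (A x / G x) * ‖A' x - (A x / G x) • G' x‖ ^ 2) := by
    intro j
    have hj : (0 : ℝ) < 1 / (j + 1) := by positivity
    obtain ⟨l, ⟨h, hh, hl⟩, hlc⟩ := exists_lt_of_csInf_lt ⟨b, hbΛ⟩
      (show sInf Λ < c + 1 / (j + 1) by linarith)
    have hmaps : MapsTo h (closedBall 0 1) (sphere 0 1) := fun u hu => by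
      simpa using hh.2.1 u (by simpa using hu)
    have hcap : IsCap N (fun u => η (h u)) := by
      refine ⟨hηc.comp hh.1 hmaps, fun u hu => (hη _ (by simpa using hh.2.1 u hu)).1,
        fun u hu => ?_⟩
      change η (h u) = u
      rw [hh.2.2 u hu]
      exact (hη u (by simpa using hu)).2.1 (hN _ u.2)
    by_contra! hcon
    have hmem : c - 1 / (j + 1) ∈ Λ := by
      refine ⟨_, hcap, fun u hu => ?_⟩
      have h1 := hh.2.1 u hu
      exact ((hη _ (by simpa using h1)).2.2).trans
        (hcon (h u) h1 ((hl u hu).trans hlc.le)).le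
    linarith [csInf_le hbdd hmem]
  choose x hx1 hx2 hx3 using hseq
  obtain ⟨z, hz, φ, hφ, hlim⟩ := (isCompact_sphere (0 : E) 1).tendsto_subseq
    (fun j => (by simpa using hx1 j : x j ∈ sphere (0 : E) 1))
  have hz1 : ‖z‖ = 1 := by simpa using hz
  have hΨt : Tendsto (fun j => A (x (φ j)) / G (x (φ j))) atTop (𝓝 (A z / G z)) :=
    ((hAc.tendsto z).comp hlim).div ((hGc.tendsto z).comp hlim) (hGs z hz1).ne'
  have hWt := ((hA'c.tendsto z).comp hlim).sub (hΨt.smul ((hG'c.tendsto z).comp hlim))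
  have hDt := hΨt.sub (((tendsto_const_nhds (x := (0 : ℝ)).max hΨt).mul
    (hWt.norm.pow 2)).const_mul κ)
  have hj0 : Tendsto (fun j => 1 / ((φ j : ℝ) + 1)) atTop (𝓝 0) :=
    tendsto_one_div_add_atTop_nhds_zero_nat.comp hφ.tendsto_atTop
  have hle1 : A z / G z ≤ c := by
    have := le_of_tendsto_of_tendsto' hΨt (hj0.const_add c) (fun j => hx2 (φ j))
    simpa using this
  have hle2 := le_of_tendsto_of_tendsto' (hj0.const_sub c) hDt (fun j => hx3 (φ j))
  rw [sub_zero] at hle2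
  have hD0 : 0 ≤ κ * (max 0 (A z / G z) * ‖A' z - (A z / G z) • G' z‖ ^ 2) := by positivity
  have hΨz : A z / G z = c := le_antisymm hle1 (by linarith)
  rw [hΨz, max_eq_right (ha.le.trans hac)] at hle2
  have hc0 : 0 < κ * c := mul_pos hκ (ha.trans_le hac)
  refine ⟨z, c, hz1, hac, hcb, ?_⟩
  have h1 : ‖A' z - c • G' z‖ ^ 2 ≤ 0 := by
    by_contra! hpos
    nlinarith [mul_pos hc0 hpos]
  have h2 : ‖A' z - c • G' z‖ = 0 := by
    nlinarith [norm_nonneg (A' z - c • G' z)]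
  exact sub_eq_zero.1 (norm_eq_zero.1 h2)

end Minimax

section Gauge

open Set Metric Filter Topology

variable {V : Type*} [NormedAddCommGroup V] [InnerProductSpace ℝ V]

/-- A positive function `F`, homogeneous of degree two and smooth away from the origin, together
with its gradient `F'` and the constants controlling its growth. -/
structure IsGauge (F : V → ℝ) (F' : V → V) (L m M : ℝ) : Prop where
  lower_pos : 0 < m
  hom : ∀ (s : ℝ) x, 0 ≤ s → F (s • x) = s ^ 2 * F x
  hom_grad : ∀ (s : ℝ) x, 0 ≤ s → F' (s • x) = s • F' x
  lip : ∀ x y, ‖F' x - F' y‖ ≤ L * ‖x - y‖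
  quad : ∀ x h, |F (x + h) - F x - ⟪F' x, h⟫| ≤ L * ‖h‖ ^ 2
  lower : ∀ x, m * ‖x‖ ^ 2 ≤ F x
  upper : ∀ x, F x ≤ M * ‖x‖ ^ 2
  smooth : ContDiffOn ℝ ∞ F' {0}ᶜ

namespace IsGauge

variable {F : V → ℝ} {F' : V → V} {L m M : ℝ}

theorem grad_zero (h : IsGauge F F' L m M) : F' 0 = 0 := by
  simpa using h.hom_grad 0 0 le_rfl

theorem map_zero (h : IsGauge F F' L m M) : F 0 = 0 := by
  simpa using h.hom 0 0 le_rfl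

theorem norm_grad_le (h : IsGauge F F' L m M) (x : V) : ‖F' x‖ ≤ L * ‖x‖ := by
  simpa [h.grad_zero] using h.lip x 0

theorem pos (h : IsGauge F F' L m M) {x : V} (hx : x ≠ 0) : 0 < F x :=
  (mul_pos h.lower_pos (pow_pos (norm_pos_iff.2 hx) 2)).trans_le (h.lower x)

theorem continuous_grad (h : IsGauge F F' L m M) : Continuous F' :=
  (LipschitzWith.of_dist_le_mul (K := L.toNNReal) fun x y => by
    rw [dist_eq_norm, dist_eq_norm]
    exact (h.lip x y).trans (by gcongr; exact le_coe_toNNReal L)).continuous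

theorem hasFDerivAt (h : IsGauge F F' L m M) (x : V) : HasFDerivAt F (innerSL ℝ (F' x)) x := by
  rw [hasFDerivAt_iff_isLittleO_nhds_zero]
  have h1 : (fun y : V => F (x + y) - F x - innerSL ℝ (F' x) y) =O[𝓝 0] fun y => ‖y‖ ^ 2 :=
    Asymptotics.IsBigO.of_bound L (Eventually.of_forall fun y => by simpa using h.quad x y)
  exact h1.trans_isLittleO (Asymptotics.isLittleO_norm_pow_id one_lt_two)

theorem continuous (h : IsGauge F F' L m M) : Continuous F :=
  continuous_iff_continuousAt.2 fun x => (h.hasFDerivAt x).continuousAt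

theorem inner_grad_self (h : IsGauge F F' L m M) (x : V) : ⟪F' x, x⟫ = 2 * F x := by
  have h1 : HasDerivAt (fun s : ℝ => F (s • x)) ⟪F' x, x⟫ 1 := by
    have h2 : HasDerivAt (fun s : ℝ => s • x) x 1 := by
      simpa using (hasDerivAt_id (1 : ℝ)).smul_const x
    have h3 := h.hasFDerivAt ((1 : ℝ) • x)
    simpa [Function.comp_def] using h3.comp_hasDerivAt (1 : ℝ) h2
  have h2 : HasDerivAt (fun s : ℝ => s ^ 2 * F x) (2 * F x) 1 := by
    simpa using (hasDerivAt_pow 2 (1 : ℝ)).mul_const (F x)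
  refine h1.unique (h2.congr_of_eventuallyEq ?_)
  filter_upwards [lt_mem_nhds one_pos] with s hs using h.hom s x hs.le

theorem nonneg_of_nontrivial [Nontrivial V] (h : IsGauge F F' L m M) : 0 ≤ L := by
  obtain ⟨x, hx⟩ := exists_ne (0 : V)
  exact nonneg_of_mul_nonneg_left ((norm_nonneg _).trans (h.norm_grad_le x)) (norm_pos_iff.2 hx)

theorem upper_pos [Nontrivial V] (h : IsGauge F F' L m M) : 0 < M := by
  obtain ⟨x, hx⟩ := exists_ne (0 : V)
  exact pos_of_mul_pos_left ((h.pos hx).trans_le (h.upper x)) (by positivity)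

end IsGauge

theorem fderiv_smul_of_homogeneous {W : Type*} [NormedAddCommGroup W] [NormedSpace ℝ W]
    {F : V → W} {k : ℕ} {s : ℝ} (hs : 0 < s) (hF : ∀ x, F (s • x) = s ^ (k + 1) • F x) (x : V) :
    fderiv ℝ F (s • x) = s ^ k • fderiv ℝ F x := by
  have h := fderiv_comp_smul (𝕜 := ℝ) (f := F) (x := x) s
  simp only [hF] at h
  change fderiv ℝ (s ^ (k + 1) • F) x = _ at h
  rw [fderiv_const_smul_field, pow_succ', mul_smul] at h
  exact (smul_right_injective _ hs.ne' h).symm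

variable [FiniteDimensional ℝ V]

theorem exists_bound_of_homogeneous {W : Type*} [NormedAddCommGroup W] [NormedSpace ℝ W]
    {F : V → W} {k : ℕ} (hc : ContinuousOn F {0}ᶜ)
    (hF : ∀ (s : ℝ) x, 0 < s → F (s • x) = s ^ k • F x) :
    ∃ C, 0 ≤ C ∧ ∀ x, x ≠ 0 → ‖F x‖ ≤ C * ‖x‖ ^ k := by
  obtain ⟨C, hC⟩ := (isCompact_sphere (0 : V) 1).exists_bound_of_continuousOn
    (hc.mono fun x hx h => by simp_all)
  refine ⟨max C 0, le_max_right _ _, fun x hx => ?_⟩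
  have hn : 0 < ‖x‖ := norm_pos_iff.2 hx
  have h1 := hC (‖x‖⁻¹ • x) (by simp [norm_smul, hn.ne'])
  have h2 := hF ‖x‖ (‖x‖⁻¹ • x) hn
  rw [smul_inv_smul₀ hn.ne'] at h2
  rw [h2, norm_smul, norm_pow, norm_norm, mul_comm]
  exact mul_le_mul_of_nonneg_right (h1.trans (le_max_left _ _)) (by positivity)

theorem isGauge_gradient {F : V → ℝ} {m : ℝ} (hm : 0 < m) (hsm : ContDiffOn ℝ ∞ F {0}ᶜ)
    (hom : ∀ (s : ℝ) x, 0 ≤ s → F (s • x) = s ^ 2 * F x) (hlow : ∀ x, m * ‖x‖ ^ 2 ≤ F x) :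
    ∃ L M, IsGauge F (gradient F) L m M := by
  have hopen : IsOpen ({0}ᶜ : Set V) := isOpen_compl_singleton
  have hF0 : F 0 = 0 := by simpa using hom 0 0 le_rfl
  have hD : ContDiffOn ℝ ∞ (fderiv ℝ F) {0}ᶜ := hsm.fderiv_of_isOpen hopen (by simp)
  have hDhom : ∀ (s : ℝ) x, 0 < s → fderiv ℝ F (s • x) = s ^ 1 • fderiv ℝ F x := fun s x hs =>
    fderiv_smul_of_homogeneous hs (fun y => by simpa using hom s y hs.le) x
  have hDDhom : ∀ (s : ℝ) x, 0 < s →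
      fderiv ℝ (fderiv ℝ F) (s • x) = s ^ 0 • fderiv ℝ (fderiv ℝ F) x := fun s x hs =>
    fderiv_smul_of_homogeneous hs (fun y => by simpa using hDhom s y hs) x
  obtain ⟨M, hM0, hM⟩ := exists_bound_of_homogeneous (k := 2) hsm.continuousOn
    (fun s x hs => by simpa using hom s x hs.le)
  obtain ⟨C₁, hC₁0, hC₁⟩ := exists_bound_of_homogeneous (k := 1) hD.continuousOn hDhom
  obtain ⟨C₂, hC₂0, hC₂⟩ := exists_bound_of_homogeneous (k := 0)
    (hD.fderiv_of_isOpen hopen (m := ∞) (by simp)).continuousOn hDDhom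
  have hMall : ∀ x, ‖F x‖ ≤ M * ‖x‖ ^ 2 := fun x => by
    rcases eq_or_ne x 0 with rfl | hx
    · simp [hF0]
    · exact hM x hx
  have hd0 : HasFDerivAt F (0 : V →L[ℝ] ℝ) 0 := by
    rw [hasFDerivAt_iff_isLittleO_nhds_zero]
    have h1 : (fun h : V => F (0 + h) - F 0 - (0 : V →L[ℝ] ℝ) h) =O[𝓝 0] fun h => ‖h‖ ^ 2 := by
      refine Asymptotics.IsBigO.of_bound M (Eventually.of_forall fun h => ?_)
      simpa [hF0] using hMall h
    exact h1.trans_isLittleO (Asymptotics.isLittleO_norm_pow_id one_lt_two)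
  have hd : ∀ x, HasFDerivAt F (fderiv ℝ F x) x := fun x => by
    rcases eq_or_ne x 0 with rfl | hx
    · rw [hd0.fderiv]; exact hd0
    · exact ((hsm.contDiffAt (hopen.mem_nhds hx)).differentiableAt (by simp)).hasFDerivAt
  have hD0 : fderiv ℝ F 0 = 0 := hd0.fderiv
  have hDall : ∀ x, ‖fderiv ℝ F x‖ ≤ max C₁ C₂ * ‖x‖ := fun x => by
    rcases eq_or_ne x 0 with rfl | hx
    · simp [hD0]
    · exact (hC₁ x hx).trans (by rw [pow_one]; gcongr; exact le_max_left _ _)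
  have hlip : ∀ x y, ‖fderiv ℝ F x - fderiv ℝ F y‖ ≤ max C₁ C₂ * ‖x - y‖ := fun x y => by
    by_cases h0 : (0 : V) ∈ segment ℝ y x
    · have h1 := dist_add_dist_of_mem_segment h0
      rw [dist_zero_right, dist_zero_left, dist_comm, dist_eq_norm] at h1
      rw [← h1, mul_add, add_comm]
      exact (norm_sub_le _ _).trans (add_le_add (hDall x) (hDall y))
    · have hne : ∀ z ∈ segment ℝ y x, z ≠ 0 := fun z hz h => h0 (h ▸ hz)
      refine (convex_segment y x).norm_image_sub_le_of_norm_fderiv_le (𝕜 := ℝ)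
        (f := fderiv ℝ F) (fun z hz => ?_) (fun z hz => ?_) (left_mem_segment ℝ y x)
        (right_mem_segment ℝ y x)
      · exact (hD.contDiffAt (hopen.mem_nhds (hne z hz))).differentiableAt (by simp)
      · exact (hC₂ z (hne z hz)).trans (by simp)
  have hdual : ∀ x y, ‖gradient F x - gradient F y‖ = ‖fderiv ℝ F x - fderiv ℝ F y‖ :=
    fun x y => by simp only [gradient, ← map_sub, LinearIsometryEquiv.norm_map]
  refine ⟨max C₁ C₂, M, hm, hom, fun s x hs => ?_, fun x y => (hdual x y).trans_le (hlip x y),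
    fun x h => ?_, hlow, fun x => (le_abs_self _).trans (hMall x), ?_⟩
  · rcases hs.eq_or_lt with rfl | hs
    · simp [gradient, hD0]
    · simp [gradient, hDhom s x hs]
  · have h1 := (convex_segment x (x + h)).norm_image_sub_le_of_norm_hasFDerivWithin_le'
      (f := F) (f' := fderiv ℝ F) (φ := fderiv ℝ F x) (C := max C₁ C₂ * ‖h‖)
      (fun z _ => (hd z).hasFDerivWithinAt)
      (fun z hz => (hlip z x).trans ?_) (left_mem_segment ℝ _ _) (right_mem_segment ℝ _ _)
    · rw [inner_gradient_left, ← Real.norm_eq_abs, sq, ← mul_assoc]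
      simpa using h1
    · have := segment_subset_closedBall_left x (x + h) hz
      rw [mem_closedBall, dist_eq_norm, dist_eq_norm] at this
      gcongr
      simpa using this
  · exact (InnerProductSpace.toDual ℝ V).symm.toContinuousLinearEquiv.contDiff.comp_contDiffOn hD

end Gauge

section Loops

open Set Metric Filter Topology MeasureTheory intervalIntegral

variable {V : Type*} [NormedAddCommGroup V] [InnerProductSpace ℝ V]

/-- An orthogonal complex structure. -/
structure IsOrthogonalComplex (J : V →L[ℝ] V) : Prop where
  sq : ∀ u, J (J u) = -u
  skew : ∀ u v, ⟪J u, v⟫ = -⟪u, J v⟫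

/-- The rotation `exp (θ J)`. -/
def rot (J : V →L[ℝ] V) (θ : ℝ) : V →L[ℝ] V := cos θ • ContinuousLinearMap.id ℝ V + sin θ • J

/-- The Fourier coefficient of index `k` of a `1`-periodic curve. -/
def loopCoeff (J : V →L[ℝ] V) (y : ℝ → V) (k : ℤ) : V :=
  ∫ t in (0 : ℝ)..1, rot J (-(2 * π * k * t)) (y t)

variable {J : V →L[ℝ] V}

theorem rot_apply (θ : ℝ) (u : V) : rot J θ u = cos θ • u + sin θ • J u := rfl

@[simp] theorem rot_zero (u : V) : rot J 0 u = u := by simp [rot_apply]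

@[simp] theorem rot_int_mul_two_pi (k : ℤ) (u : V) : rot J (k * (2 * π)) u = u := by
  have h : sin (k * (2 * π)) = 0 := by simpa using sin_add_int_mul_two_pi 0 k
  simp [rot_apply, cos_int_mul_two_pi, h]

@[fun_prop]
theorem Continuous.rot {X : Type*} [TopologicalSpace X] {θ : X → ℝ} {y : X → V}
    (hθ : Continuous θ) (hy : Continuous y) : Continuous fun x => rot J (θ x) (y x) := by
  simp only [rot_apply]; fun_prop

theorem IsOrthogonalComplex.inner_self (hJ : IsOrthogonalComplex J) (u : V) : ⟪J u, u⟫ = 0 := by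
  have := hJ.skew u u
  rw [real_inner_comm] at this
  rw [real_inner_comm]
  linarith

theorem IsOrthogonalComplex.rot_add (hJ : IsOrthogonalComplex J) (θ φ : ℝ) (u : V) :
    rot J (θ + φ) u = rot J θ (rot J φ u) := by
  simp only [rot_apply, map_add, map_smul, hJ.sq, cos_add, sin_add]
  module

theorem IsOrthogonalComplex.inner_rot_left (hJ : IsOrthogonalComplex J) (θ : ℝ) (u v : V) :
    ⟪rot J θ u, v⟫ = ⟪u, rot J (-θ) v⟫ := by
  simp [rot_apply, inner_add_left, inner_add_right, inner_smul_left, inner_smul_right, hJ.skew]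

theorem IsOrthogonalComplex.norm_rot (hJ : IsOrthogonalComplex J) (θ : ℝ) (u : V) :
    ‖rot J θ u‖ = ‖u‖ := by
  have h : ‖rot J θ u‖ ^ 2 = ‖u‖ ^ 2 := by
    rw [← real_inner_self_eq_norm_sq, hJ.inner_rot_left, ← hJ.rot_add, neg_add_cancel, rot_zero,
      real_inner_self_eq_norm_sq]
  exact (pow_left_inj₀ (norm_nonneg _) (norm_nonneg _) two_ne_zero).1 h

theorem hasDerivAt_rot (hJ : IsOrthogonalComplex J) (θ : ℝ) (u : V) :
    HasDerivAt (fun θ => rot J θ u) (J (rot J θ u)) θ := by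
  have h := ((hasDerivAt_cos θ).smul_const u).add ((hasDerivAt_sin θ).smul_const (J u))
  refine h.congr_deriv ?_
  simp only [rot_apply, map_add, map_smul, hJ.sq]
  module

theorem hasDerivAt_rot_mul (hJ : IsOrthogonalComplex J) (c t : ℝ) (u : V) :
    HasDerivAt (fun t => rot J (c * t) u) (c • J (rot J (c * t) u)) t := by
  have h := (hasDerivAt_rot hJ (c * t) u).scomp t ((hasDerivAt_id t).const_mul c)
  simpa [Function.comp_def] using h

theorem integral_rot [CompleteSpace V] (hJ : IsOrthogonalComplex J) (k : ℤ) (u : V) :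
    ∫ t in (0 : ℝ)..1, rot J (2 * π * k * t) u = if k = 0 then u else 0 := by
  split_ifs with hk
  · simp [hk]
  · have hc : (2 * π * k : ℝ) ≠ 0 := by simp [hk, pi_ne_zero]
    have h := integral_eq_sub_of_hasDerivAt (a := 0) (b := 1)
      (fun t _ => hasDerivAt_rot_mul hJ (2 * π * k) t (-((2 * π * k)⁻¹ • J u)))
      (Continuous.intervalIntegrable (by fun_prop) _ _)
    have h2 : ∀ v : V, rot J (2 * π * k * 1) v = v := fun v => by
      rw [show 2 * π * (k : ℝ) * 1 = k * (2 * π) by ring, rot_int_mul_two_pi]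
    rw [h2, mul_zero, rot_zero, sub_self] at h
    rw [← h]
    refine integral_congr fun t _ => ?_
    simp only [rot_apply, map_neg, map_add, map_smul, hJ.sq]
    match_scalars <;> field_simp

theorem inner_loopCoeff [CompleteSpace V] (hJ : IsOrthogonalComplex J) {y : ℝ → V}
    (hy : Continuous y) (k : ℤ) (u : V) :
    ⟪loopCoeff J y k, u⟫ = ∫ t in (0 : ℝ)..1, ⟪y t, rot J (2 * π * k * t) u⟫ := by
  have h := ContinuousLinearMap.intervalIntegral_comp_comm (innerSL ℝ u) (a := 0) (b := 1)
    (μ := volume) (f := fun t => rot J (-(2 * π * k * t)) (y t))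
    (Continuous.intervalIntegrable (by fun_prop) _ _)
  rw [real_inner_comm, loopCoeff]
  refine h.symm.trans (integral_congr fun t _ => ?_)
  simp [real_inner_comm, ← hJ.inner_rot_left]

variable {ι : Type*} [Fintype ι] {κ : ι → ℤ}

/-- The trigonometric loop with frequencies `κ` and coefficients `a`. -/
def trigLoop (J : V →L[ℝ] V) (κ : ι → ℤ) (a : ι → V) (t : ℝ) : V :=
  ∑ i, rot J (2 * π * κ i * t) (a i)

theorem continuous_trigLoop (a : ι → V) : Continuous (trigLoop J κ a) := by
  unfold trigLoop; fun_prop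

theorem inner_trigLoop_integral [CompleteSpace V] (hJ : IsOrthogonalComplex J) {y : ℝ → V}
    (hy : Continuous y) (b : ι → V) :
    ∫ t in (0 : ℝ)..1, ⟪y t, trigLoop J κ b t⟫ = ∑ i, ⟪loopCoeff J y (κ i), b i⟫ := by
  simp only [trigLoop, inner_sum]
  rw [integral_finsetSum fun i _ => Continuous.intervalIntegrable (by fun_prop) _ _]
  exact Finset.sum_congr rfl fun i _ => (inner_loopCoeff hJ hy _ _).symm

theorem loopCoeff_trigLoop [CompleteSpace V] (hJ : IsOrthogonalComplex J)
    (hκ : Function.Injective κ) (a : ι → V) (i : ι) :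
    loopCoeff J (trigLoop J κ a) (κ i) = a i := by
  classical
  have h : ∀ j t, rot J (-(2 * π * κ i * t)) (rot J (2 * π * κ j * t) (a j)) =
      rot J (2 * π * (κ j - κ i : ℤ) * t) (a j) := fun j t => by
    rw [← hJ.rot_add]; congr 2; push_cast; ring
  simp only [loopCoeff, trigLoop, map_sum, h]
  rw [integral_finsetSum fun i _ => Continuous.intervalIntegrable (by fun_prop) _ _]
  simp only [integral_rot hJ, sub_eq_zero, hκ.eq_iff, Finset.sum_ite_eq', Finset.mem_univ, if_true]

theorem integral_norm_sq_trigLoop [CompleteSpace V] (hJ : IsOrthogonalComplex J)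
    (hκ : Function.Injective κ) (a : ι → V) :
    ∫ t in (0 : ℝ)..1, ‖trigLoop J κ a t‖ ^ 2 = ∑ i, ‖a i‖ ^ 2 := by
  simp only [← real_inner_self_eq_norm_sq]
  rw [inner_trigLoop_integral hJ (continuous_trigLoop a)]
  simp [loopCoeff_trigLoop hJ hκ]

end Loops

section Galerkin

open Set Metric Filter Topology MeasureTheory intervalIntegral

variable {V : Type*} [NormedAddCommGroup V] [InnerProductSpace ℝ V] {J : V →L[ℝ] V}
  {F : V → ℝ} {F' : V → V} {L m M : ℝ} {ι : Type*} [Fintype ι] {κ : ι → ℤ}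

theorem trigLoop_add (a b : ι → V) (t : ℝ) :
    trigLoop J κ (a + b) t = trigLoop J κ a t + trigLoop J κ b t := by
  simp [trigLoop, Finset.sum_add_distrib]

theorem trigLoop_smul (s : ℝ) (a : ι → V) (t : ℝ) :
    trigLoop J κ (s • a) t = s • trigLoop J κ a t := by
  simp [trigLoop, Finset.smul_sum]

theorem IsGauge.integral_quad [CompleteSpace V] (hF : IsGauge F F' L m M)
    (hJ : IsOrthogonalComplex J) (hκ : Function.Injective κ) (a h : ι → V) :
    |(∫ t in (0 : ℝ)..1, F (trigLoop J κ (a + h) t)) - (∫ t in (0 : ℝ)..1, F (trigLoop J κ a t))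
      - ∑ i, ⟪loopCoeff J (fun t => F' (trigLoop J κ a t)) (κ i), h i⟫| ≤ L * ∑ i, ‖h i‖ ^ 2 := by
  have hc := continuous_trigLoop (J := J) (κ := κ)
  have hFc := hF.continuous
  have hF'c := hF.continuous_grad
  have hi : ∀ b : ι → V, IntervalIntegrable (fun t => F (trigLoop J κ b t)) volume 0 1 :=
    fun b => (hFc.comp (hc b)).intervalIntegrable _ _
  have hc1 : Continuous fun t => ⟪F' (trigLoop J κ a t), trigLoop J κ h t⟫ :=
    (hF'c.comp (hc a)).inner (hc h)
  rw [← inner_trigLoop_integral hJ (y := fun t => F' (trigLoop J κ a t)) (hF'c.comp (hc a)),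
    ← integral_norm_sq_trigLoop hJ hκ,
    ← integral_sub (hi _) (hi _), ← integral_sub ((hi _).sub (hi _)) (hc1.intervalIntegrable _ _),
    ← intervalIntegral.integral_const_mul, ← Real.norm_eq_abs]
  refine norm_integral_le_of_norm_le zero_le_one (ae_of_all _ fun t _ => ?_)
    (Continuous.intervalIntegrable (by have := hc h; fun_prop) _ _)
  rw [trigLoop_add, Real.norm_eq_abs]
  exact hF.quad _ _

/-- The Euclidean space of coefficients of trigonometric loops. -/
abbrev FourierSpace (ι V : Type*) [Fintype ι] [NormedAddCommGroup V] : Type _ :=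
  PiLp 2 fun _ : ι => V

/-- The coefficients supported at nonpositive frequencies. -/
def lowFreq (κ : ι → ℤ) : Submodule ℝ (FourierSpace ι V) where
  carrier := {a | ∀ i, 1 ≤ κ i → a i = 0}
  add_mem' ha hb i hi := by simp [ha i hi, hb i hi]
  zero_mem' i _ := rfl
  smul_mem' s a ha i hi := by simp [ha i hi]

theorem apply_eq_zero_of_mem_lowFreq_orthogonal {a : FourierSpace ι V} (ha : a ∈ (lowFreq κ)ᗮ)
    {i : ι} (hi : κ i ≤ 0) : a i = 0 := by
  classical
  have h1 := (Submodule.mem_orthogonal _ a).1 ha (PiLp.single 2 i (a i)) fun j hj =>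
    PiLp.single_eq_of_ne _ (fun h => by subst h; omega) _
  rw [PiLp.inner_apply, Finset.sum_eq_single i
    (fun j _ hj => by rw [PiLp.single_eq_of_ne _ hj, inner_zero_left]) (by simp)] at h1
  simpa using h1

theorem FourierSpace.norm_sq {V : Type*} [NormedAddCommGroup V] (a : FourierSpace ι V) :
    ‖a‖ ^ 2 = ∑ i, ‖a i‖ ^ 2 :=
  PiLp.norm_sq_eq_of_L2 _ a

/-- The symplectic action of a trigonometric loop, in terms of its coefficients. -/
def loopAction (κ : ι → ℤ) (a : FourierSpace ι V) : ℝ := ∑ i, π * κ i * ‖a i‖ ^ 2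

/-- The gradient of `loopAction`. -/
def loopActionGrad (κ : ι → ℤ) (a : FourierSpace ι V) : FourierSpace ι V :=
  WithLp.toLp 2 fun i => (2 * π * κ i) • a i

/-- The integral of `F` along a trigonometric loop. -/
def loopEnergy (J : V →L[ℝ] V) (F : V → ℝ) (κ : ι → ℤ) (a : FourierSpace ι V) : ℝ :=
  ∫ t in (0 : ℝ)..1, F (trigLoop J κ a t)

/-- The gradient of `loopEnergy`. -/
def loopEnergyGrad (J : V →L[ℝ] V) (F' : V → V) (κ : ι → ℤ) (a : FourierSpace ι V) :
    FourierSpace ι V :=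
  WithLp.toLp 2 fun i => loopCoeff J (fun t => F' (trigLoop J κ a t)) (κ i)

theorem continuous_trigLoop_fourierSpace :
    Continuous fun p : FourierSpace ι V × ℝ => trigLoop J κ p.1 p.2 := by
  unfold trigLoop; fun_prop

theorem continuous_loopEnergy (hF : Continuous F) : Continuous (loopEnergy J F κ) :=
  continuous_parametric_intervalIntegral_of_continuous'
    (f := fun (a : FourierSpace ι V) t => F (trigLoop J κ a t))
    (hF.comp continuous_trigLoop_fourierSpace) _ _

theorem continuous_loopEnergyGrad (hF : Continuous F') : Continuous (loopEnergyGrad J F' κ) :=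
  (PiLp.continuous_toLp _ _).comp (continuous_pi fun i =>
    continuous_parametric_intervalIntegral_of_continuous'
      (Continuous.rot (by fun_prop) (hF.comp continuous_trigLoop_fourierSpace)) _ _)

theorem loopAction_quad {K : ℝ} (hK : ∀ i, |(κ i : ℝ)| ≤ K) (x h : FourierSpace ι V) :
    |loopAction κ (x + h) - loopAction κ x - ⟪loopActionGrad κ x, h⟫| ≤ π * K * ‖h‖ ^ 2 := by
  have h1 : loopAction κ (x + h) - loopAction κ x - ⟪loopActionGrad κ x, h⟫ =
      ∑ i, π * κ i * ‖h i‖ ^ 2 := by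
    simp only [loopAction, loopActionGrad, PiLp.inner_apply, ← Finset.sum_sub_distrib]
    refine Finset.sum_congr rfl fun i _ => ?_
    rw [PiLp.add_apply, norm_add_sq_real, real_inner_smul_left]
    ring
  rw [h1, FourierSpace.norm_sq, Finset.mul_sum]
  refine (Finset.abs_sum_le_sum_abs _ _).trans (Finset.sum_le_sum fun i _ => ?_)
  rw [abs_mul, abs_mul, abs_of_pos pi_pos, abs_of_nonneg (sq_nonneg ‖h i‖)]
  gcongr
  exact hK i

theorem loopAction_smul (s : ℝ) (x : FourierSpace ι V) :
    loopAction κ (s • x) = s ^ 2 * loopAction κ x := by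
  simp only [loopAction, Finset.mul_sum]
  refine Finset.sum_congr rfl fun i _ => ?_
  rw [PiLp.smul_apply, norm_smul, mul_pow, Real.norm_eq_abs, sq_abs]
  ring

theorem loopAction_nonpos {x : FourierSpace ι V} (hx : x ∈ lowFreq κ) : loopAction κ x ≤ 0 := by
  refine Finset.sum_nonpos fun i _ => ?_
  by_cases hi : 1 ≤ κ i
  · simp [hx i hi]
  · have : (κ i : ℝ) ≤ 0 := by exact_mod_cast (by omega : κ i ≤ 0)
    exact mul_nonpos_of_nonpos_of_nonneg (mul_nonpos_of_nonneg_of_nonpos pi_pos.le this)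
      (sq_nonneg _)

theorem loopAction_le {V : Type*} [NormedAddCommGroup V] {x : FourierSpace ι V}
    (hx : ∀ i, 2 ≤ κ i → x i = 0) :
    loopAction κ x ≤ π * ‖x‖ ^ 2 := by
  rw [FourierSpace.norm_sq, Finset.mul_sum]
  refine Finset.sum_le_sum fun i _ => ?_
  by_cases hi : κ i ≤ 1
  · have : (κ i : ℝ) ≤ 1 := by exact_mod_cast hi
    gcongr
    exact mul_le_of_le_one_right pi_pos.le this
  · simp [hx i (by omega)]

theorem le_loopAction {x : FourierSpace ι V} (hx : x ∈ (lowFreq κ)ᗮ) :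
    π * ‖x‖ ^ 2 ≤ loopAction κ x := by
  rw [FourierSpace.norm_sq, Finset.mul_sum]
  refine Finset.sum_le_sum fun i _ => ?_
  by_cases hi : κ i ≤ 0
  · simp [apply_eq_zero_of_mem_lowFreq_orthogonal hx hi]
  · have : (1 : ℝ) ≤ κ i := by exact_mod_cast (by omega : 1 ≤ κ i)
    gcongr
    exact le_mul_of_one_le_right pi_pos.le this

theorem loopEnergy_smul (hF : IsGauge F F' L m M) {s : ℝ} (hs : 0 ≤ s) (x : FourierSpace ι V) :
    loopEnergy J F κ (s • x) = s ^ 2 * loopEnergy J F κ x := by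
  simp only [loopEnergy, WithLp.ofLp_smul, trigLoop_smul]
  rw [← intervalIntegral.integral_const_mul]
  exact integral_congr fun t _ => hF.hom s _ hs

theorem loopEnergy_bounds [CompleteSpace V] (hF : IsGauge F F' L m M)
    (hJ : IsOrthogonalComplex J) (hκ : Function.Injective κ) (a : FourierSpace ι V) :
    m * ‖a‖ ^ 2 ≤ loopEnergy J F κ a ∧ loopEnergy J F κ a ≤ M * ‖a‖ ^ 2 := by
  have hc := continuous_trigLoop (J := J) (κ := κ) a
  have hi := (hF.continuous.comp hc).intervalIntegrable (μ := volume) 0 1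
  have hi' (C : ℝ) : IntervalIntegrable (fun t => C * ‖trigLoop J κ a t‖ ^ 2) volume 0 1 :=
    Continuous.intervalIntegrable (by fun_prop) _ _
  rw [FourierSpace.norm_sq, ← integral_norm_sq_trigLoop hJ hκ,
    ← intervalIntegral.integral_const_mul, ← intervalIntegral.integral_const_mul]
  exact ⟨integral_mono_on zero_le_one (hi' m) hi fun t _ => hF.lower _,
    integral_mono_on zero_le_one hi (hi' M) fun t _ => hF.upper _⟩

theorem exists_galerkin [FiniteDimensional ℝ V] [Nontrivial V] (hF : IsGauge F F' L m M)
    (hJ : IsOrthogonalComplex J) (hκ : Function.Injective κ) {i₁ : ι} (hi₁ : κ i₁ = 1) :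
    ∃ (a : ι → V) (T : ℝ), ∑ i, ‖a i‖ ^ 2 = 1 ∧ π / M ≤ T ∧ T ≤ π / m ∧
      ∀ i, (2 * π * κ i) • a i = T • loopCoeff J (fun t => F' (trigLoop J κ a t)) (κ i) := by
  classical
  have hM := hF.upper_pos
  have hm := hF.lower_pos
  obtain ⟨K, hK⟩ : ∃ K : ℝ, ∀ i, |(κ i : ℝ)| ≤ K :=
    ⟨∑ i, |(κ i : ℝ)|, fun i => Finset.single_le_sum (f := fun i => |(κ i : ℝ)|)
      (fun _ _ => abs_nonneg _) (Finset.mem_univ i)⟩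
  obtain ⟨v, hv⟩ := exists_norm_eq V zero_le_one
  have hbd := loopEnergy_bounds hF hJ hκ
  have he : PiLp.single 2 i₁ v ∈ (lowFreq κ : Submodule ℝ (FourierSpace ι V))ᗮ := by
    refine (Submodule.mem_orthogonal _ _).2 fun u hu => ?_
    rw [PiLp.inner_apply]
    refine Finset.sum_eq_zero fun i _ => ?_
    rcases eq_or_ne i i₁ with rfl | hi
    · rw [hu i hi₁.ge, inner_zero_left]
    · rw [PiLp.single_eq_of_ne _ hi, inner_zero_right]
  have hNe : ∀ x ∈ lowFreq κ, ∀ s : ℝ, loopAction κ (x + s • PiLp.single 2 i₁ v) ≤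
      π / m * loopEnergy J F κ (x + s • PiLp.single 2 i₁ v) := fun x hx s => by
    refine (loopAction_le fun i hi => ?_).trans ?_
    · rw [PiLp.add_apply, PiLp.smul_apply, hx i (by omega),
        PiLp.single_eq_of_ne _ (fun h => by subst h; omega), smul_zero, add_zero]
    · rw [div_mul_eq_mul_div, le_div_iff₀ hm, mul_assoc, mul_comm _ m]
      gcongr
      exact (hbd _).1
  have hP : ∀ x ∈ (lowFreq κ)ᗮ, π / M * loopEnergy J F κ x ≤ loopAction κ x := fun x hx => by
    refine le_trans ?_ (le_loopAction hx)
    rw [div_mul_eq_mul_div, div_le_iff₀ hM, mul_assoc, mul_comm _ M]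
    gcongr
    exact (hbd _).2
  obtain ⟨a, T, ha, hT1, hT2, hcrit⟩ := exists_critical_quotient
    (A := loopAction κ) (G := loopEnergy J F κ) (A' := loopActionGrad κ)
    (G' := loopEnergyGrad J F' κ) (L := max L (π * K)) (a := π / M) (b := π / m)
    (by unfold loopAction; fun_prop) (continuous_loopEnergy hF.continuous)
    (by unfold loopActionGrad; fun_prop) (continuous_loopEnergyGrad hF.continuous_grad)
    (fun s x _ => loopAction_smul s x) (fun s x hs => loopEnergy_smul hF hs x)
    (fun x hx => (mul_pos hm (pow_pos (norm_pos_iff.2 hx) 2)).trans_le (hbd x).1)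
    (fun x h => (loopAction_quad hK x h).trans (by gcongr; exact le_max_right _ _))
    (fun x h => (hF.integral_quad hJ hκ x h).trans
      (by rw [← FourierSpace.norm_sq]; gcongr; exact le_max_left _ _))
    (lowFreq κ) he (by rw [PiLp.norm_single, hv]) (by positivity)
    (fun x hx => loopAction_nonpos hx) hNe hP
  exact ⟨a, T, by rw [← FourierSpace.norm_sq, ha, one_pow], hT1, hT2,
    fun i => congrFun (congrArg WithLp.ofLp hcrit) i⟩

end Galerkin

section Decay

open Set Metric Filter Topology MeasureTheory intervalIntegral

variable {V : Type*} [NormedAddCommGroup V] [InnerProductSpace ℝ V] {J : V →L[ℝ] V}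
  {F : V → ℝ} {F' : V → V} {L m M : ℝ} {ι : Type*} [Fintype ι] {κ : ι → ℤ}

theorem IsOrthogonalComplex.norm_rot_sub_le (hJ : IsOrthogonalComplex J) (θ : ℝ) (u : V) :
    ‖rot J θ u - u‖ ≤ |θ| * ‖u‖ := by
  have h1 : ⟪rot J θ u, u⟫ = cos θ * ‖u‖ ^ 2 := by
    rw [rot_apply, inner_add_left, inner_smul_left, inner_smul_left, hJ.inner_self,
      real_inner_self_eq_norm_sq]
    simp
  have h2 : ‖rot J θ u - u‖ ^ 2 ≤ (|θ| * ‖u‖) ^ 2 := by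
    rw [norm_sub_sq_real, h1, hJ.norm_rot, mul_pow, sq_abs]
    nlinarith [one_sub_sq_div_two_le_cos (x := θ), sq_nonneg ‖u‖]
  exact le_of_sq_le_sq h2 (by positivity)

theorem rot_intCast_mul_add_one (k : ℤ) (hJ : IsOrthogonalComplex J) (t : ℝ) (u : V) :
    rot J (2 * π * k * (t + 1)) u = rot J (2 * π * k * t) u := by
  rw [mul_add, hJ.rot_add, mul_one, show 2 * π * (k : ℝ) = k * (2 * π) by ring,
    rot_int_mul_two_pi]

theorem periodic_trigLoop (hJ : IsOrthogonalComplex J) (a : ι → V) :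
    Function.Periodic (trigLoop J κ a) 1 := fun t => by
  simp only [trigLoop, rot_intCast_mul_add_one _ hJ]

theorem trigLoop_add_sub (hJ : IsOrthogonalComplex J) (a : ι → V) (t h : ℝ) :
    trigLoop J κ a (t + h) - trigLoop J κ a t =
      trigLoop J κ (fun i => rot J (2 * π * κ i * h) (a i) - a i) t := by
  simp only [trigLoop, ← Finset.sum_sub_distrib, map_sub, mul_add, hJ.rot_add]

theorem loopCoeff_sub {y z : ℝ → V} (hy : Continuous y) (hz : Continuous z) (k : ℤ) :
    loopCoeff J (fun t => y t - z t) k = loopCoeff J y k - loopCoeff J z k := by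
  simp only [loopCoeff, map_sub]
  exact integral_sub (Continuous.intervalIntegrable (by fun_prop) _ _)
    (Continuous.intervalIntegrable (by fun_prop) _ _)

theorem loopCoeff_comp_add [CompleteSpace V] (hJ : IsOrthogonalComplex J) {y : ℝ → V}
    (hy : Continuous y) (hper : Function.Periodic y 1) (k : ℤ) (h : ℝ) :
    loopCoeff J (fun t => y (t + h)) k = rot J (2 * π * k * h) (loopCoeff J y k) := by
  have hg : Function.Periodic (fun t => rot J (-(2 * π * k * t)) (y t)) 1 := fun t => by
    have := rot_intCast_mul_add_one (-k) hJ t (y t)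
    push_cast at this
    simpa only [hper t, mul_neg, neg_mul] using this
  have h1 := hg.intervalIntegral_add_eq h 0
  rw [zero_add] at h1
  rw [loopCoeff, loopCoeff, ← h1, ← ContinuousLinearMap.intervalIntegral_comp_comm _
    (Continuous.intervalIntegrable (by fun_prop) _ _), add_comm h 1]
  have h2 := intervalIntegral.integral_comp_add_right (a := 0) (b := 1)
    (fun t => rot J (2 * π * k * h) (rot J (-(2 * π * k * t)) (y t))) h
  rw [zero_add] at h2
  rw [← h2]
  refine integral_congr fun t _ => ?_
  simp only [← hJ.rot_add]
  congr 2
  ring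

theorem sum_norm_sq_loopCoeff_le [CompleteSpace V] (hJ : IsOrthogonalComplex J)
    (hκ : Function.Injective κ) {y : ℝ → V} (hy : Continuous y) :
    ∑ i, ‖loopCoeff J y (κ i)‖ ^ 2 ≤ ∫ t in (0 : ℝ)..1, ‖y t‖ ^ 2 := by
  have hc := continuous_trigLoop (J := J) (κ := κ) fun i => loopCoeff J y (κ i)
  have h1 := inner_trigLoop_integral (κ := κ) hJ hy fun i => loopCoeff J y (κ i)
  simp only [real_inner_self_eq_norm_sq] at h1
  have h2 : ∫ t in (0 : ℝ)..1, 2 * ⟪y t, trigLoop J κ (fun i => loopCoeff J y (κ i)) t⟫ ≤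
      ∫ t in (0 : ℝ)..1, (‖y t‖ ^ 2 + ‖trigLoop J κ (fun i => loopCoeff J y (κ i)) t‖ ^ 2) := by
    refine integral_mono_on zero_le_one (Continuous.intervalIntegrable (by fun_prop) _ _)
      (Continuous.intervalIntegrable (by fun_prop) _ _) fun t _ => ?_
    have := norm_sub_sq_real (y t) (trigLoop J κ (fun i => loopCoeff J y (κ i)) t)
    nlinarith [sq_nonneg ‖y t - trigLoop J κ (fun i => loopCoeff J y (κ i)) t‖]
  rw [intervalIntegral.integral_const_mul, h1, integral_add
    (Continuous.intervalIntegrable (by fun_prop) _ _)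
    (Continuous.intervalIntegrable (by fun_prop) _ _), integral_norm_sq_trigLoop hJ hκ] at h2
  linarith

theorem norm_sq_loopCoeff_le [CompleteSpace V] (hJ : IsOrthogonalComplex J) {y : ℝ → V}
    (hy : Continuous y) (k : ℤ) : ‖loopCoeff J y k‖ ^ 2 ≤ ∫ t in (0 : ℝ)..1, ‖y t‖ ^ 2 := by
  simpa using sum_norm_sq_loopCoeff_le (κ := fun _ : Unit => k) hJ
    (Function.injective_of_subsingleton _) hy

theorem norm_loopCoeff_grad_le [CompleteSpace V] (hF : IsGauge F F' L m M) (hL : 0 ≤ L)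
    (hJ : IsOrthogonalComplex J) (hκ : Function.Injective κ) {a : ι → V} {T : ℝ} (hT : 0 ≤ T)
    (ha : ∑ i, ‖a i‖ ^ 2 = 1)
    (h : ∀ i, (2 * π * κ i) • a i = T • loopCoeff J (fun t => F' (trigLoop J κ a t)) (κ i))
    {k : ℤ} (hk : k ≠ 0) :
    ‖loopCoeff J (fun t => F' (trigLoop J κ a t)) k‖ ≤ T * L ^ 2 / (4 * |(k : ℝ)|) := by
  set x := trigLoop J κ a with hx
  have hxc : Continuous x := continuous_trigLoop a
  have hF'c := hF.continuous_grad
  have hyc : Continuous fun t => F' (x t) := hF'c.comp hxc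
  have hper : Function.Periodic x 1 := periodic_trigLoop hJ a
  have hk' : (k : ℝ) ≠ 0 := by exact_mod_cast hk
  -- the `L²` norm of the derivative
  have h1 : ∑ i, ‖(2 * π * κ i) • a i‖ ^ 2 ≤ (T * L) ^ 2 := by
    simp only [h, norm_smul, mul_pow, Real.norm_eq_abs, sq_abs, ← Finset.mul_sum]
    gcongr
    refine (sum_norm_sq_loopCoeff_le hJ hκ hyc).trans ?_
    calc ∫ t in (0 : ℝ)..1, ‖F' (x t)‖ ^ 2 ≤ ∫ t in (0 : ℝ)..1, L ^ 2 * ‖x t‖ ^ 2 := by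
          refine integral_mono_on zero_le_one (Continuous.intervalIntegrable (by fun_prop) _ _)
            (Continuous.intervalIntegrable (by fun_prop) _ _) fun t _ => ?_
          rw [← mul_pow]
          gcongr
          exact hF.norm_grad_le _
      _ = L ^ 2 := by
          rw [intervalIntegral.integral_const_mul, integral_norm_sq_trigLoop hJ hκ, ha, mul_one]
  -- translate by half a period of the `k`-th mode
  set s : ℝ := 1 / (2 * k) with hs
  have h2 : ∫ t in (0 : ℝ)..1, ‖x (t + s) - x t‖ ^ 2 ≤ s ^ 2 * (T * L) ^ 2 := by
    simp only [hx, trigLoop_add_sub hJ]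
    rw [integral_norm_sq_trigLoop hJ hκ]
    refine le_trans ?_ (mul_le_mul_of_nonneg_left h1 (sq_nonneg s))
    rw [Finset.mul_sum]
    refine Finset.sum_le_sum fun i _ => ?_
    rw [← sq_abs s, ← mul_pow]
    gcongr
    refine (hJ.norm_rot_sub_le _ _).trans_eq ?_
    rw [norm_smul, Real.norm_eq_abs, abs_mul _ s]
    ring
  have h3 : loopCoeff J (fun t => F' (x (t + s)) - F' (x t)) k =
      (-2 : ℝ) • loopCoeff J (fun t => F' (x t)) k := by
    rw [loopCoeff_sub (by fun_prop) hyc, loopCoeff_comp_add hJ hyc (hper.comp F'),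
      show 2 * π * k * s = π by rw [hs]; field_simp, rot_apply, cos_pi, sin_pi]
    module
  have h4 : (2 * ‖loopCoeff J (fun t => F' (x t)) k‖) ^ 2 ≤ (L * (|s| * (T * L))) ^ 2 := by
    calc (2 * ‖loopCoeff J (fun t => F' (x t)) k‖) ^ 2
        = ‖loopCoeff J (fun t => F' (x (t + s)) - F' (x t)) k‖ ^ 2 := by
          rw [h3, norm_smul]; norm_num
      _ ≤ ∫ t in (0 : ℝ)..1, ‖F' (x (t + s)) - F' (x t)‖ ^ 2 :=
          norm_sq_loopCoeff_le hJ (by fun_prop) k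
      _ ≤ ∫ t in (0 : ℝ)..1, L ^ 2 * ‖x (t + s) - x t‖ ^ 2 := by
          refine integral_mono_on zero_le_one (Continuous.intervalIntegrable (by fun_prop) _ _)
            (Continuous.intervalIntegrable (by fun_prop) _ _) fun t _ => ?_
          rw [← mul_pow]
          gcongr
          exact hF.lip _ _
      _ ≤ (L * (|s| * (T * L))) ^ 2 := by
          rw [intervalIntegral.integral_const_mul, mul_pow L, mul_pow |s|, sq_abs]
          gcongr
  have h5 := le_of_sq_le_sq h4 (by positivity)
  have h6 : |s| = 1 / (2 * |(k : ℝ)|) := by rw [hs]; simp [abs_mul]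
  rw [h6] at h5
  have hkp := abs_pos.2 hk'
  rw [le_div_iff₀ (by positivity)]
  field_simp at h5
  linarith

end Decay

section WeakLimit

open Set Metric Filter Topology MeasureTheory intervalIntegral

variable {V : Type*} [NormedAddCommGroup V] [InnerProductSpace ℝ V] {J : V →L[ℝ] V}
  {F : V → ℝ} {F' : V → V} {L m M : ℝ}

/-- The Fourier series with coefficients `a`. -/
def loopSeries (J : V →L[ℝ] V) (a : ℤ → V) (t : ℝ) : V := ∑' k : ℤ, rot J (2 * π * k * t) (a k)

theorem loopSeries_eq_trigLoop {s : Finset ℤ} {a : ℤ → V} (ha : ∀ k ∉ s, a k = 0) :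
    loopSeries J a = trigLoop J (fun k : s => (k : ℤ)) fun k => a k := by
  ext t
  rw [loopSeries, tsum_eq_sum (s := s) (fun k hk => by rw [ha k hk, map_zero]), trigLoop,
    ← Finset.sum_coe_sort]

theorem continuous_loopSeries [CompleteSpace V] (hJ : IsOrthogonalComplex J) {a : ℤ → V} {D : ℤ → ℝ}
    (hD : Summable D) (ha : ∀ k, ‖a k‖ ≤ D k) : Continuous (loopSeries J a) :=
  continuous_tsum (fun k => by fun_prop) hD fun k t => (hJ.norm_rot _ _).trans_le (ha k)

theorem norm_loopSeries_le (hJ : IsOrthogonalComplex J) {a : ℤ → V} {D : ℤ → ℝ}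
    (hD : Summable D) (ha : ∀ k, ‖a k‖ ≤ D k) (t : ℝ) : ‖loopSeries J a t‖ ≤ ∑' k, D k :=
  tsum_of_norm_bounded hD.hasSum fun k => (hJ.norm_rot _ _).trans_le (ha k)

theorem periodic_loopSeries (hJ : IsOrthogonalComplex J) (a : ℤ → V) :
    Function.Periodic (loopSeries J a) 1 := fun t => by
  simp only [loopSeries, rot_intCast_mul_add_one _ hJ]

theorem tendsto_loopSeries [CompleteSpace V] (hJ : IsOrthogonalComplex J) {a : ℕ → ℤ → V}
    {b : ℤ → V} {D : ℤ → ℝ} (hD : Summable D) (ha : ∀ n k, ‖a n k‖ ≤ D k)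
    (h : ∀ k, Tendsto (fun n => a n k) atTop (𝓝 (b k))) (t : ℝ) :
    Tendsto (fun n => loopSeries J (a n) t) atTop (𝓝 (loopSeries J b t)) :=
  tendsto_tsum_of_dominated_convergence hD
    (fun k => ((rot J (2 * π * k * t)).continuous.tendsto _).comp (h k))
    (Eventually.of_forall fun n k => (hJ.norm_rot _ _).trans_le (ha n k))

theorem tendsto_loopCoeff (hJ : IsOrthogonalComplex J) {y : ℕ → ℝ → V} {z : ℝ → V}
    {B : ℝ} (hy : ∀ n, Continuous (y n)) (hB : ∀ n t, ‖y n t‖ ≤ B)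
    (h : ∀ t, Tendsto (fun n => y n t) atTop (𝓝 (z t))) (k : ℤ) :
    Tendsto (fun n => loopCoeff J (y n) k) atTop (𝓝 (loopCoeff J z k)) :=
  tendsto_integral_filter_of_dominated_convergence (fun _ => B)
    (Eventually.of_forall fun n => by
      have := hy n
      exact Continuous.aestronglyMeasurable (by fun_prop))
    (Eventually.of_forall fun n => ae_of_all _ fun t _ => (hJ.norm_rot _ _).trans_le (hB n t))
    intervalIntegrable_const
    (ae_of_all _ fun t _ => ((rot J (-(2 * π * k * t))).continuous.tendsto _).comp (h t))

variable [FiniteDimensional ℝ V] [Nontrivial V]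

theorem exists_approximate_loops (hF : IsGauge F F' L m M) (hJ : IsOrthogonalComplex J) :
    ∃ D : ℤ → ℝ, Summable D ∧ ∀ n : ℕ, ∃ (a : ℤ → V) (T : ℝ), T ∈ Icc (π / M) (π / m) ∧
      (∀ k, ‖a k‖ ≤ D k) ∧
      ∫ t in (0 : ℝ)..1, ‖loopSeries J a t‖ ^ 2 = 1 ∧
      ∀ k : ℤ, |k| ≤ n + 1 → loopCoeff J (loopSeries J a) k = a k ∧
        (2 * π * k) • a k = T • loopCoeff J (fun t => F' (loopSeries J a t)) k := by
  have hL := hF.nonneg_of_nontrivial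
  have hm := hF.lower_pos
  have hM := hF.upper_pos
  set C : ℝ := π / m * (π / m * L ^ 2 / (4 * (2 * π))) with hC
  have hC0 : 0 ≤ C := by positivity
  refine ⟨fun k => Pi.single (M := fun _ => ℝ) 0 1 k + C * (1 / (k : ℝ) ^ 2),
    (hasSum_pi_single 0 (1 : ℝ)).summable.add
      ((Real.summable_one_div_int_pow.2 one_lt_two).mul_left C), fun n => ?_⟩
  set s : Finset ℤ := Finset.Icc (-(n + 1 : ℤ)) (n + 1) with hs
  have hmem : ∀ k, k ∈ s ↔ |k| ≤ n + 1 := fun k => by rw [hs, Finset.mem_Icc, abs_le]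
  have hinj : Function.Injective fun k : s => (k : ℤ) := Subtype.val_injective
  obtain ⟨a, T, ha, hT1, hT2, heq⟩ := exists_galerkin (i₁ := (⟨1, by rw [hmem]; simp⟩ : s)) hF hJ
    hinj rfl
  have hT0 : 0 ≤ T := le_trans (by positivity) hT1
  let b : ℤ → V := fun k => if h : k ∈ s then a ⟨k, h⟩ else 0
  have hb0 : ∀ k ∉ s, b k = 0 := fun k hk => dif_neg hk
  have hba : ∀ k : s, b k = a k := fun k => dif_pos k.2
  have hx : loopSeries J b = trigLoop J (fun k : s => (k : ℤ)) a := by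
    rw [loopSeries_eq_trigLoop hb0]; simp only [hba]
  refine ⟨b, T, ⟨hT1, hT2⟩, fun k => ?_, ?_, fun k hk => ?_⟩
  · beta_reduce
    by_cases hk : k ∈ s
    · have ha1 : ‖a ⟨k, hk⟩‖ ≤ 1 := by
        have := Finset.single_le_sum (f := fun i => ‖a i‖ ^ 2) (fun _ _ => sq_nonneg _)
          (Finset.mem_univ (⟨k, hk⟩ : s))
        rw [ha] at this
        exact (sq_le_one_iff₀ (norm_nonneg _)).1 this
      rw [hba ⟨k, hk⟩]
      rcases eq_or_ne k 0 with rfl | hk0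
      · simpa using ha1
      · rw [Pi.single_eq_of_ne hk0, zero_add]
        have hkp : 0 < |(k : ℝ)| := abs_pos.2 (by exact_mod_cast hk0)
        have h1 := norm_loopCoeff_grad_le hF hL hJ hinj hT0 ha heq hk0
        have h2 := congrArg norm (heq ⟨k, hk⟩)
        simp only [norm_smul, Real.norm_eq_abs, abs_of_nonneg hT0, abs_mul, abs_of_pos pi_pos,
          abs_of_pos (zero_lt_two (α := ℝ))] at h2
        have h3 : 2 * π * |(k : ℝ)| * ‖a ⟨k, hk⟩‖ ≤
            π / m * (π / m * L ^ 2 / (4 * |(k : ℝ)|)) := by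
          rw [h2]
          refine mul_le_mul hT2 (h1.trans ?_) (norm_nonneg _) (by positivity)
          gcongr
        rw [mul_comm, ← le_div_iff₀ (by positivity)] at h3
        refine h3.trans_eq ?_
        rw [hC, ← sq_abs (k : ℝ)]
        field_simp
    · rw [hb0 k hk, norm_zero]
      have : (0 : ℝ) ≤ Pi.single (M := fun _ => ℝ) 0 1 k := by
        rcases eq_or_ne k 0 with rfl | hk0
        · simp
        · simp [hk0]
      positivity
  · rw [hx, integral_norm_sq_trigLoop hJ hinj, ha]
  · have hk' := (hmem k).2 hk
    rw [hx, hba ⟨k, hk'⟩]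
    exact ⟨loopCoeff_trigLoop hJ hinj a ⟨k, hk'⟩, heq ⟨k, hk'⟩⟩

theorem exists_weak_periodic_orbit (hF : IsGauge F F' L m M) (hJ : IsOrthogonalComplex J) :
    ∃ (x : ℝ → V) (T : ℝ), T ∈ Icc (π / M) (π / m) ∧ Continuous x ∧ Function.Periodic x 1 ∧
      ∫ t in (0 : ℝ)..1, ‖x t‖ ^ 2 = 1 ∧
      ∀ k : ℤ, (2 * π * k) • loopCoeff J x k = T • loopCoeff J (fun t => F' (x t)) k := by
  obtain ⟨D, hD, h⟩ := exists_approximate_loops hF hJ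
  choose a T hT haD hnorm heq using h
  have hcpt : IsCompact (Icc (π / M) (π / m) ×ˢ pi univ fun k => closedBall (0 : V) (D k)) :=
    isCompact_Icc.prod (isCompact_univ_pi fun k => isCompact_closedBall _ _)
  obtain ⟨⟨T₀, b⟩, hmem, φ, hφ, hlim⟩ := hcpt.tendsto_subseq (x := fun n => (T n, a n))
    fun n => ⟨hT n, fun k _ => by simpa using haD n k⟩
  have hTlim : Tendsto (fun n => T (φ n)) atTop (𝓝 T₀) :=
    (continuous_fst.tendsto _).comp hlim
  have halim : ∀ k, Tendsto (fun n => a (φ n) k) atTop (𝓝 (b k)) := fun k =>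
    (((continuous_apply k).comp continuous_snd).tendsto (T₀, b)).comp hlim
  have hbD : ∀ k, ‖b k‖ ≤ D k := fun k => by simpa using hmem.2 k (mem_univ k)
  have hxlim := tendsto_loopSeries hJ hD (fun n => haD (φ n)) halim
  have hxc := continuous_loopSeries hJ hD hbD
  have hxnc := fun n => continuous_loopSeries hJ hD (haD (φ n))
  have hxn := fun n => norm_loopSeries_le hJ hD (haD (φ n))
  have hF'c := hF.continuous_grad
  have hk : ∀ k : ℤ, ∀ᶠ n : ℕ in atTop, |k| ≤ (φ n : ℤ) + 1 := fun k => by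
    filter_upwards [eventually_ge_atTop k.natAbs] with n hn
    have := hφ.id_le n
    rw [Int.abs_eq_natAbs]
    simp only [id] at this
    omega
  refine ⟨loopSeries J b, T₀, hmem.1, hxc, periodic_loopSeries hJ b, ?_, fun k => ?_⟩
  · have h1 : Tendsto (fun n => ∫ t in (0 : ℝ)..1, ‖loopSeries J (a (φ n)) t‖ ^ 2) atTop
        (𝓝 (∫ t in (0 : ℝ)..1, ‖loopSeries J b t‖ ^ 2)) :=
      tendsto_integral_filter_of_dominated_convergence (fun _ => (∑' k, D k) ^ 2)
        (Eventually.of_forall fun n => ((hxnc n).norm.pow 2).aestronglyMeasurable)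
        (Eventually.of_forall fun n => ae_of_all _ fun t _ => by
          rw [norm_pow, norm_norm]; gcongr; exact hxn n t)
        intervalIntegrable_const (ae_of_all _ fun t _ => (hxlim t).norm.pow 2)
    simp only [hnorm] at h1
    exact tendsto_nhds_unique h1 tendsto_const_nhds
  · have h1 := tendsto_loopCoeff hJ hxnc hxn hxlim k
    have h2 : Tendsto (fun n => (2 * π * k) • a (φ n) k) atTop
        (𝓝 ((2 * π * k) • loopCoeff J (loopSeries J b) k)) := by
      refine Tendsto.congr' ?_ (h1.const_smul (2 * π * (k : ℝ)))
      filter_upwards [hk k] with n hn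
      rw [(heq (φ n) k hn).1]
    have h3 := hTlim.smul (tendsto_loopCoeff hJ (fun n => hF'c.comp (hxnc n))
      (fun n t => (hF.norm_grad_le _).trans
        (mul_le_mul_of_nonneg_left (hxn n t) hF.nonneg_of_nontrivial))
      (fun t => (hF'c.tendsto _).comp (hxlim t)) k)
    refine tendsto_nhds_unique_of_eventuallyEq h2 h3 ?_
    filter_upwards [hk k] with n hn using (heq (φ n) k hn).2

end WeakLimit

section StrongSolution

open Set Metric Filter Topology MeasureTheory intervalIntegral

variable {V : Type*} [NormedAddCommGroup V] [InnerProductSpace ℝ V] {J : V →L[ℝ] V}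
  {F : V → ℝ} {F' : V → V} {L m M : ℝ}

theorem eq_zero_of_fourier_integral_eq_zero {g : ℝ → ℂ} (hg : Continuous g)
    (hper : Function.Periodic g 1)
    (h : ∀ k : ℤ, ∫ t in (0 : ℝ)..1, Complex.exp (-(2 * π * k * t : ℝ) * Complex.I) * g t = 0)
    (t : ℝ) : g t = 0 := by
  have : Fact ((0 : ℝ) < 1) := ⟨one_pos⟩
  let G : C(AddCircle (1 : ℝ), ℂ) := ⟨hper.lift, continuous_coinduced_dom.2 hg⟩
  have hc : ∀ k, fourierCoeff G k = 0 := fun k => by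
    rw [fourierCoeff_eq_intervalIntegral G k 0, zero_add]
    simp only [div_one, one_smul]
    rw [← h k]
    refine integral_congr fun t _ => ?_
    simp only [fourier_coe_apply, smul_eq_mul]
    congr 2
    push_cast
    ring
  have hs := has_pointwise_sum_fourier_series_of_summable (f := G)
    (by simpa only [funext hc] using summable_zero) (t : AddCircle (1 : ℝ))
  simp only [hc, zero_smul] at hs
  exact hs.unique hasSum_zero

/-- The complex linear functional, for the complex structure `J`, whose real part is `⟪·, v⟫`. -/
def complexInner (J : V →L[ℝ] V) (v : V) : V →L[ℝ] ℂ :=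
  Complex.ofRealCLM.comp (innerSL ℝ v) + Complex.I • Complex.ofRealCLM.comp (innerSL ℝ (J v))

theorem complexInner_apply (v u : V) :
    complexInner J v u = (⟪v, u⟫ : ℂ) + Complex.I * (⟪J v, u⟫ : ℝ) := by
  simp [complexInner]

theorem complexInner_rot (hJ : IsOrthogonalComplex J) (v u : V) (θ : ℝ) :
    complexInner J v (rot J θ u) = Complex.exp (θ * Complex.I) * complexInner J v u := by
  have h1 : ⟪v, J u⟫ = -⟪J v, u⟫ := by rw [hJ.skew, neg_neg]
  have h2 : ⟪J v, J u⟫ = ⟪v, u⟫ := by rw [hJ.skew, hJ.sq, inner_neg_right, neg_neg]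
  simp only [complexInner_apply, rot_apply, inner_add_right, inner_smul_right, h1, h2,
    Complex.exp_mul_I]
  push_cast
  linear_combination (-Complex.sin θ * ⟪J v, u⟫) * Complex.I_sq

theorem eq_zero_of_loopCoeff_eq_zero [CompleteSpace V] (hJ : IsOrthogonalComplex J) {w : ℝ → V}
    (hw : Continuous w) (hper : Function.Periodic w 1) (h : ∀ k, loopCoeff J w k = 0) (t : ℝ) :
    w t = 0 := by
  have key : ∀ v, complexInner J v (w t) = 0 := fun v => by
    refine eq_zero_of_fourier_integral_eq_zero (g := fun t => complexInner J v (w t))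
      (by fun_prop) (hper.comp _) (fun k => ?_) t
    have h1 := ContinuousLinearMap.intervalIntegral_comp_comm (complexInner J v) (a := 0) (b := 1)
      (μ := volume) (f := fun t => rot J (-(2 * π * k * t)) (w t))
      (Continuous.intervalIntegrable (by fun_prop) _ _)
    have h2 := h k
    rw [loopCoeff] at h2
    rw [h2, map_zero] at h1
    rw [← h1]
    refine integral_congr fun t _ => ?_
    simp only [complexInner_rot hJ]
    push_cast
    rfl
  have h1 := key (w t)
  rw [complexInner_apply, hJ.inner_self, Complex.ofReal_zero, mul_zero, add_zero,
    Complex.ofReal_eq_zero] at h1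
  exact inner_self_eq_zero.1 h1

theorem loopCoeff_const [CompleteSpace V] (hJ : IsOrthogonalComplex J) (u : V) (k : ℤ) :
    loopCoeff J (fun _ => u) k = if k = 0 then u else 0 := by
  have h := integral_rot hJ (-k) u
  push_cast at h
  simpa only [loopCoeff, mul_neg, neg_mul, neg_eq_zero] using h

/-- A periodic curve satisfying an ordinary differential equation in the sense of Fourier
coefficients is differentiable and solves it. -/
theorem hasDerivAt_of_loopCoeff [CompleteSpace V] (hJ : IsOrthogonalComplex J) {x y : ℝ → V}
    (hx : Continuous x) (hy : Continuous y) (hxp : Function.Periodic x 1)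
    (hyp : Function.Periodic y 1)
    (h : ∀ k : ℤ, (2 * π * k) • loopCoeff J x k = loopCoeff J y k) (t : ℝ) :
    HasDerivAt x (J (y t)) t := by
  have hJy : Continuous fun t => J (y t) := by fun_prop
  have hy0 : ∫ t in (0 : ℝ)..1, J (y t) = 0 := by
    have h0 := h 0
    simp only [loopCoeff, Int.cast_zero, mul_zero, zero_mul, neg_zero, rot_zero, zero_smul] at h0
    rw [ContinuousLinearMap.intervalIntegral_comp_comm _ (hy.intervalIntegrable _ _), ← h0,
      map_zero]
  set z : ℝ → V := fun t => ∫ s in (0 : ℝ)..t, J (y s) with hz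
  have hzd : ∀ t, HasDerivAt z (J (y t)) t := fun t =>
    (hJy.integral_hasStrictDerivAt 0 t).hasDerivAt
  have hzc : Continuous z := continuous_iff_continuousAt.2 fun t => (hzd t).continuousAt
  have hzp : Function.Periodic z 1 := fun t => by
    have h1 := (hyp.comp J).intervalIntegral_add_eq t 0
    simp only [Function.comp_apply, zero_add] at h1
    rw [hz]
    simp only
    rw [← integral_add_adjacent_intervals (hJy.intervalIntegrable 0 t)
      (hJy.intervalIntegrable t (t + 1)), h1, hy0, add_zero]
  have hzk : ∀ k : ℤ, (2 * π * k) • loopCoeff J z k = loopCoeff J y k := fun k => by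
    have hd : ∀ t, HasDerivAt (fun t => rot J (-(2 * π * k * t)) (z t))
        (rot J (-(2 * π * k * t)) (J (y t)) - J ((2 * π * k) • rot J (-(2 * π * k * t)) (z t)))
        t := fun t => by
      have hlin : HasDerivAt (fun t : ℝ => -(2 * π * k * t)) (-(2 * π * k)) t := by
        simpa only [id, mul_one] using ((hasDerivAt_id t).const_mul (2 * π * k)).fun_neg
      have h1 := (hlin.cos.smul (hzd t)).add
        (hlin.sin.smul (J.hasFDerivAt.comp_hasDerivAt t (hzd t)))
      refine h1.congr_deriv ?_
      simp only [rot_apply, map_add, map_smul, hJ.sq, Function.comp_apply]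
      module
    have h1 := integral_eq_sub_of_hasDerivAt (a := 0) (b := 1) (fun t _ => hd t)
      (Continuous.intervalIntegrable (by fun_prop) _ _)
    have h2 : ∀ v : V, rot J (-(2 * π * k * 1)) v = v := fun v => by
      have := rot_int_mul_two_pi (J := J) (-k) v
      rw [← this]
      congr 2
      push_cast
      ring
    have h3 : z 1 = z 0 := by simpa using hzp 0
    have h4 : ∀ t, rot J (-(2 * π * k * t)) (J (y t)) = J (rot J (-(2 * π * k * t)) (y t)) :=
      fun t => by simp only [rot_apply, map_add, map_smul]
    rw [h2, h3, mul_zero, neg_zero, rot_zero, sub_self] at h1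
    simp only [h4, ← map_sub] at h1
    rw [ContinuousLinearMap.intervalIntegral_comp_comm _
      (Continuous.intervalIntegrable (by fun_prop) _ _), integral_sub
      (Continuous.intervalIntegrable (by fun_prop) _ _)
      (Continuous.intervalIntegrable (by fun_prop) _ _), intervalIntegral.integral_smul] at h1
    have h5 := congrArg J h1
    rw [hJ.sq, map_zero, neg_eq_zero, sub_eq_zero] at h5
    exact h5.symm
  set c : V := loopCoeff J (fun t => x t - z t) 0 with hcdef
  have hw := eq_zero_of_loopCoeff_eq_zero hJ (w := fun t => x t - z t - c) (by fun_prop)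
    (fun t => by simp only [hxp t, hzp t]) fun k => by
      rw [loopCoeff_sub (by fun_prop) continuous_const, loopCoeff_const hJ]
      rcases eq_or_ne k 0 with rfl | hk
      · simp [hcdef]
      · rw [if_neg hk, sub_zero, loopCoeff_sub hx hzc, sub_eq_zero]
        refine smul_right_injective V (r := 2 * π * (k : ℝ)) ?_ ((h k).trans (hzk k).symm)
        simp [hk, pi_ne_zero]
  have hxz : x = fun t => z t + c := funext fun t => by
    have := hw t
    rw [sub_sub, sub_eq_zero] at this
    exact this
  rw [hxz]
  exact (hzd t).add_const c

theorem exists_periodic_orbit [FiniteDimensional ℝ V] [Nontrivial V] (hF : IsGauge F F' L m M)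
    (hJ : IsOrthogonalComplex J) :
    ∃ (x : ℝ → V) (T : ℝ), 0 < T ∧ T ≤ π / m ∧ Function.Periodic x 1 ∧ (∃ t, x t ≠ 0) ∧
      ∀ t, HasDerivAt x (T • J (F' (x t))) t := by
  obtain ⟨x, T, hT, hxc, hxp, hnorm, h⟩ := exists_weak_periodic_orbit hF hJ
  have hM := hF.upper_pos
  have hF'c := hF.continuous_grad
  refine ⟨x, T, lt_of_lt_of_le (by positivity) hT.1, hT.2, hxp, ?_, fun t => ?_⟩
  · by_contra! h0
    simp [h0] at hnorm
  · have := hasDerivAt_of_loopCoeff hJ hxc (y := fun t => T • F' (x t)) (by fun_prop) hxp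
      (fun t => by simp only [hxp t]) (fun k => by
        rw [h k]
        simp only [loopCoeff, map_smul]
        exact (intervalIntegral.integral_smul _ _).symm) t
    rwa [map_smul] at this

end StrongSolution

section Characteristic

open Set Metric Filter Topology

variable {V : Type*} [NormedAddCommGroup V] [InnerProductSpace ℝ V] {J : V →L[ℝ] V}
  {F : V → ℝ} {F' : V → V} {L m M : ℝ}

theorem contDiff_of_hasDerivAt {γ : ℝ → V} {X : V → V} (hX : ContDiffOn ℝ ∞ X {0}ᶜ)
    (h0 : ∀ t, γ t ≠ 0) (h : ∀ t, HasDerivAt γ (X (γ t)) t) : ContDiff ℝ ∞ γ := by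
  refine contDiff_infty.2 fun n => ?_
  induction n with
  | zero => exact contDiff_zero.2 (continuous_iff_continuousAt.2 fun t => (h t).continuousAt)
  | succ n ih =>
    have hd : deriv γ = fun t => X (γ t) := funext fun t => (h t).deriv
    rw [Nat.cast_succ, contDiff_succ_iff_deriv]
    refine ⟨fun t => (h t).differentiableAt, by simp, ?_⟩
    rw [hd]
    exact (hX.of_le (by exact_mod_cast le_top)).comp_contDiff ih h0

theorem exists_closed_characteristic [FiniteDimensional ℝ V] [Nontrivial V]
    (hF : IsGauge F F' L m M) (hJ : IsOrthogonalComplex J) :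
    ∃ (γ : ℝ → V) (T : ℝ), 0 < T ∧ T ≤ π / m ∧ (∀ t, γ (t + T) = γ t) ∧ (∀ t, F (γ t) = 1) ∧
      (∀ t, HasDerivAt γ (J (F' (γ t))) t) ∧ ContDiff ℝ ∞ γ := by
  obtain ⟨x, T, hT0, hT, hper, ⟨t₀, ht₀⟩, hd⟩ := exists_periodic_orbit hF hJ
  have hFd : ∀ t, HasDerivAt (fun t => F (x t)) 0 t := fun t => by
    have := (hF.hasFDerivAt (x t)).comp_hasDerivAt t (hd t)
    refine this.congr_deriv ?_
    rw [map_smul, innerSL_apply_apply, real_inner_comm, hJ.inner_self, smul_zero]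
  set c : ℝ := F (x t₀) with hc
  have hconst : ∀ t, F (x t) = c := fun t =>
    is_const_of_deriv_eq_zero (fun t => (hFd t).differentiableAt) (fun t => (hFd t).deriv) t t₀
  have hcpos : 0 < c := hF.pos ht₀
  have hs : 0 ≤ (√c)⁻¹ := by positivity
  have hγd : ∀ t, HasDerivAt (fun t => (√c)⁻¹ • x (t / T)) (J (F' ((√c)⁻¹ • x (t / T)))) t :=
    fun t => by
      have h1 := ((hd (t / T)).scomp t ((hasDerivAt_id t).div_const T)).const_smul (√c)⁻¹
      refine h1.congr_deriv ?_
      rw [hF.hom_grad _ _ hs, map_smul, smul_smul (1 / T), one_div_mul_cancel hT0.ne', one_smul]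
  have hF1 : ∀ t, F ((√c)⁻¹ • x (t / T)) = 1 := fun t => by
    rw [hF.hom _ _ hs, hconst, inv_pow, sq_sqrt hcpos.le, inv_mul_cancel₀ hcpos.ne']
  refine ⟨fun t => (√c)⁻¹ • x (t / T), T, hT0, hT, fun t => ?_, hF1, hγd, ?_⟩
  · simp only [add_div, div_self hT0.ne', hper (t / T)]
  · refine contDiff_of_hasDerivAt (X := fun u => J (F' u)) (J.contDiff.comp_contDiffOn hF.smooth)
      (fun t h0 => ?_) hγd
    have := hF1 t
    rw [h0, hF.map_zero] at this
    exact zero_ne_one this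

/-- The function, homogeneous of degree two, whose unit level set is
`{√(f p) • p | ‖p‖ = 1}`. -/
def starGauge (f : V → ℝ) (x : V) : ℝ := ‖x‖ ^ 2 / f (‖x‖⁻¹ • x)

theorem starGauge_smul (f : V → ℝ) {s : ℝ} (hs : 0 ≤ s) (x : V) :
    starGauge f (s • x) = s ^ 2 * starGauge f x := by
  rcases hs.eq_or_lt with rfl | hs
  · simp [starGauge]
  · rw [starGauge, starGauge, norm_smul, Real.norm_of_nonneg hs.le, mul_inv, mul_comm s⁻¹,
      mul_smul, inv_smul_smul₀ hs.ne', mul_pow, mul_div_assoc]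

theorem inv_norm_smul_mem_sphere {x : V} (hx : x ≠ 0) : ‖x‖⁻¹ • x ∈ sphere (0 : V) 1 := by
  simp [norm_smul, hx]

theorem contDiffOn_starGauge {f : V → ℝ} (hf : ContDiff ℝ ∞ f)
    (hpos : ∀ p ∈ sphere (0 : V) 1, 0 < f p) : ContDiffOn ℝ ∞ (starGauge f) {0}ᶜ := by
  intro x hx
  refine ContDiffAt.contDiffWithinAt ?_
  have hn : ContDiffAt ℝ ∞ (fun x : V => ‖x‖) x := contDiffAt_norm ℝ hx
  exact (hn.pow 2).div (hf.contDiffAt.comp x ((hn.inv (norm_ne_zero_iff.2 hx)).smul contDiffAt_id))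
    (hpos _ (inv_norm_smul_mem_sphere hx)).ne'

theorem exists_isGauge_starGauge [FiniteDimensional ℝ V] [Nontrivial V] {f : V → ℝ}
    (hf : ContDiff ℝ ∞ f) (hpos : ∀ p ∈ sphere (0 : V) 1, 0 < f p) :
    ∃ L M, IsGauge (starGauge f) (gradient (starGauge f)) L (sSup (f '' sphere (0 : V) 1))⁻¹ M := by
  have hle : ∀ p ∈ sphere (0 : V) 1, f p ≤ sSup (f '' sphere (0 : V) 1) := fun p hp =>
    le_csSup ((isCompact_sphere 0 1).bddAbove_image hf.continuous.continuousOn)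
      (mem_image_of_mem f hp)
  obtain ⟨v, hv⟩ := exists_ne (0 : V)
  have hv' := inv_norm_smul_mem_sphere hv
  refine isGauge_gradient (inv_pos.2 ((hpos _ hv').trans_le (hle _ hv')))
    (contDiffOn_starGauge hf hpos) (fun s x hs => starGauge_smul f hs x) fun x => ?_
  rcases eq_or_ne x 0 with rfl | hx
  · simp [starGauge]
  · have hx' := inv_norm_smul_mem_sphere hx
    rw [starGauge, div_eq_inv_mul]
    gcongr
    · exact hpos _ hx'
    · exact hle _ hx'

theorem starGauge_sqrt_smul {f : V → ℝ} {p : V} (hp : ‖p‖ = 1) (hpos : 0 < f p) :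
    starGauge f (√(f p) • p) = 1 := by
  rw [starGauge_smul f (sqrt_nonneg _), sq_sqrt hpos.le, starGauge, hp]
  simp [hpos.ne']

theorem sqrt_smul_eq_of_starGauge_eq_one {f : V → ℝ} {x : V} (h : starGauge f x = 1) :
    √(f (‖x‖⁻¹ • x)) • ‖x‖⁻¹ • x = x := by
  have hf0 : f (‖x‖⁻¹ • x) ≠ 0 := fun h0 => by simp [starGauge, h0] at h
  have hx : x ≠ 0 := fun h0 => by simp [starGauge, h0] at h
  rw [starGauge, div_eq_one_iff_eq hf0] at h
  rw [← h, sqrt_sq (norm_nonneg _), smul_inv_smul₀ (norm_ne_zero_iff.2 hx)]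

theorem hasDerivAt_normalized_line {p v : V} (hp : ‖p‖ = 1) (hpv : ⟪p, v⟫ = 0) :
    ∃ q : ℝ → V, q 0 = p ∧ (∀ s, ‖q s‖ = 1) ∧ HasDerivAt q v 0 := by
  refine ⟨fun s => (√(1 + s ^ 2 * ‖v‖ ^ 2))⁻¹ • (p + s • v), by simp, fun s => ?_, ?_⟩
  · have h1 : ‖p + s • v‖ ^ 2 = 1 + s ^ 2 * ‖v‖ ^ 2 := by
      rw [norm_add_sq_real, inner_smul_right, hpv, hp, norm_smul, mul_pow, Real.norm_eq_abs, sq_abs]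
      ring
    have h2 : 0 < ‖p + s • v‖ := by
      refine (sq_pos_iff.1 ?_).lt_of_le' (norm_nonneg _)
      rw [h1]; positivity
    rw [norm_smul, ← h1, sqrt_sq (norm_nonneg _), norm_inv, norm_norm, inv_mul_cancel₀ h2.ne']
  · have h1 : HasDerivAt (fun s : ℝ => 1 + s ^ 2 * ‖v‖ ^ 2) 0 0 := by
      simpa using ((hasDerivAt_pow 2 (0 : ℝ)).mul_const (‖v‖ ^ 2)).const_add 1
    have h2 := (h1.sqrt (by simp)).fun_inv (by simp)
    have h3 : HasDerivAt (fun s : ℝ => p + s • v) v 0 := by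
      simpa using ((hasDerivAt_id (0 : ℝ)).smul_const v).const_add p
    simpa using h2.fun_smul h3

variable {f : V → ℝ}

theorem inner_grad_fderiv_eq_zero (hF : IsGauge (starGauge f) F' L m M)
    (hpos : ∀ p ∈ sphere (0 : V) 1, 0 < f p) {p v : V} (hp : ‖p‖ = 1)
    (hΦ : DifferentiableAt ℝ (fun x => √(f x) • x) p) (hpv : ⟪p, v⟫ = 0) :
    ⟪F' (√(f p) • p), fderiv ℝ (fun x => √(f x) • x) p v⟫ = 0 := by
  obtain ⟨q, hq0, hq1, hqd⟩ := hasDerivAt_normalized_line hp hpv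
  have h1 : HasDerivAt (fun s => √(f (q s)) • q s) (fderiv ℝ (fun x => √(f x) • x) p v) 0 := by
    rw [← hq0] at hΦ ⊢
    exact hΦ.hasFDerivAt.comp_hasDerivAt 0 hqd
  have h2 := (hF.hasFDerivAt _).comp_hasDerivAt 0 h1
  rw [hq0, innerSL_apply_apply] at h2
  refine h2.unique ((hasDerivAt_const (0 : ℝ) (1 : ℝ)).congr_of_eventuallyEq
    (Eventually.of_forall fun s => ?_))
  exact starGauge_sqrt_smul (hq1 s) (hpos _ (by simpa using hq1 s))

theorem mem_image_fderiv (hF : IsGauge (starGauge f) F' L m M) (hf : ContDiff ℝ ∞ f)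
    (hpos : ∀ p ∈ sphere (0 : V) 1, 0 < f p) {p u : V} (hp : ‖p‖ = 1)
    (hu : ⟪F' (√(f p) • p), u⟫ = 0) :
    u ∈ (fderiv ℝ (fun x => √(f x) • x) p) '' {v | ⟪p, v⟫ = 0} := by
  have hfp : 0 < f p := hpos p (by simpa using hp)
  have hr := ((hf.differentiable (by simp) p).hasFDerivAt.sqrt hfp.ne').fun_smul
    (hasFDerivAt_id p)
  set v : V := (√(f p))⁻¹ • (u - ⟪p, u⟫ • p) with hv
  have hpv : ⟪p, v⟫ = 0 := by
    rw [hv, inner_smul_right, inner_sub_right, inner_smul_right, real_inner_self_eq_norm_sq, hp]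
    ring
  obtain ⟨β, hβ⟩ : ∃ β : ℝ, fderiv ℝ (fun x => √(f x) • x) p v = u + β • p := by
    have h1 : √(f p) • v = u - ⟪p, u⟫ • p := by rw [hv, smul_inv_smul₀ (sqrt_pos.2 hfp).ne']
    refine ⟨(1 / (2 * √(f p))) * fderiv ℝ f p v - ⟪p, u⟫, ?_⟩
    have h2 := congrArg (fun A : V →L[ℝ] V => A v) hr.fderiv
    refine h2.trans ?_
    simp only [add_apply, smul_apply,
      ContinuousLinearMap.smulRight_apply, ContinuousLinearMap.id_apply, h1, id]
    module
  have h3 := inner_grad_fderiv_eq_zero hF hpos hp hr.differentiableAt hpv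
  rw [hβ, inner_add_right, hu, zero_add, inner_smul_right,
    hF.hom_grad _ _ (sqrt_nonneg _), inner_smul_left, hF.inner_grad_self] at h3
  have h4 : 0 < starGauge f p := hF.pos (fun h => by simp [h] at hp)
  have h5 : 0 < √(f p) := sqrt_pos.2 hfp
  have h6 : β = 0 := by
    rcases mul_eq_zero.1 h3 with h | h
    · exact h
    · have : (0 : ℝ) < √(f p) * (2 * starGauge f p) := by positivity
      exact absurd h this.ne'
  exact ⟨v, hpv, by rw [hβ, h6, zero_smul, add_zero]⟩

end Characteristic

section Standard

/-- The complex structure on ℝ⁴ representing `omegaSt` through the Euclidean inner product. -/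
def complexSt : R4 →L[ℝ] R4 :=
  LinearMap.toContinuousLinearMap
    { toFun := fun u => !₂[-u 1, u 0, -u 3, u 2]
      map_add' := fun u v => by ext i; fin_cases i <;> simp <;> ring
      map_smul' := fun c u => by ext i; fin_cases i <;> simp }

theorem complexSt_apply (u : R4) : complexSt u = !₂[-u 1, u 0, -u 3, u 2] := rfl

theorem omegaSt_eq_inner (u v : R4) : omegaSt u v = ⟪complexSt u, v⟫ := by
  simp [omegaSt, complexSt_apply, PiLp.inner_apply, Fin.sum_univ_four]
  ring

theorem isOrthogonalComplex_complexSt : IsOrthogonalComplex complexSt where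
  sq u := by ext i; fin_cases i <;> simp [complexSt_apply]
  skew u v := by
    simp [complexSt_apply, PiLp.inner_apply, Fin.sum_univ_four]
    ring

end Standard

/-- The contact form λ_st|TS on a star-shaped hypersurface
S = {√(f(p))·p : p ∈ S³} has a closed (automatically contractible) Reeb orbit
of period at most π · max f. The smooth function f : S³ → (0,∞) is encoded by
a smooth extension to ℝ⁴ which is positive on the unit sphere. -/
theorem starshaped_reeb_orbit_short
    (f : R4 → ℝ) (hf : ContDiff ℝ ∞ f)
    (hfpos : ∀ p ∈ Metric.sphere (0 : R4) 1, 0 < f p)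
    (Φ : R4 → R4) (hΦ : ∀ x, Φ x = Real.sqrt (f x) • x)
    (S : Set R4) (hS : S = Φ '' Metric.sphere (0 : R4) 1) :
    ∃ (T : ℝ) (γ : ℝ → R4), 0 < T ∧
      T ≤ π * sSup (f '' Metric.sphere (0 : R4) 1) ∧ ContDiff ℝ ∞ γ ∧ (∃ t s, γ t ≠ γ s) ∧
      (∀ t, γ t ∈ S) ∧
      (∀ t, γ (t + T) = γ t) ∧
      (∀ t : ℝ, ∃ p ∈ Metric.sphere (0 : R4) 1, γ t = Φ p ∧
        -- γ′(t) is tangent to S at γ(t):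
        deriv γ t ∈ (fderiv ℝ Φ p) '' {v : R4 | ⟪p, v⟫ = 0} ∧
        -- γ′(t) lies in the kernel of dα = ω_st restricted to T_{γ(t)}S:
        (∀ w ∈ (fderiv ℝ Φ p) '' {v : R4 | ⟪p, v⟫ = 0},
          omegaSt (deriv γ t) w = 0) ∧
        -- normalisation λ_st(γ(t))(γ′(t)) = 1:
        lambdaSt (γ t) (deriv γ t) = 1) := by
  obtain rfl : Φ = fun x => √(f x) • x := funext hΦ
  subst hS
  have hJ := isOrthogonalComplex_complexSt
  obtain ⟨L, M, hG⟩ := exists_isGauge_starGauge hf hfpos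
  obtain ⟨γ, T, hT0, hT, hper, hlevel, hd, hsmooth⟩ := exists_closed_characteristic hG hJ
  have hne : ∀ t, γ t ≠ 0 := fun t h => by
    have := hlevel t
    rw [h, hG.map_zero] at this
    exact zero_ne_one this
  have hsph : ∀ t, ‖γ t‖⁻¹ • γ t ∈ Metric.sphere (0 : R4) 1 := fun t =>
    inv_norm_smul_mem_sphere (hne t)
  have hΦγ : ∀ t, √(f (‖γ t‖⁻¹ • γ t)) • ‖γ t‖⁻¹ • γ t = γ t := fun t =>
    sqrt_smul_eq_of_starGauge_eq_one (hlevel t)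
  refine ⟨T, γ, hT0, by rwa [div_inv_eq_mul] at hT, hsmooth, ?_, fun t => ⟨_, hsph t, hΦγ t⟩, hper,
    fun t => ⟨_, hsph t, (hΦγ t).symm, ?_, ?_, ?_⟩⟩
  · by_contra! hconst
    have h0 : HasDerivAt γ 0 0 := by
      rw [show γ = fun _ => γ 0 from funext fun t => hconst t 0]
      exact hasDerivAt_const _ _
    have h1 := congrArg complexSt ((hd 0).unique h0)
    rw [hJ.sq, map_zero, neg_eq_zero] at h1
    have h2 := hG.inner_grad_self (γ 0)
    rw [h1, inner_zero_left, hlevel] at h2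
    norm_num at h2
  · refine mem_image_fderiv hG hf hfpos (by simpa using hsph t) ?_
    rw [hΦγ, (hd t).deriv, real_inner_comm]
    exact hJ.inner_self _
  · rintro _ ⟨v, hv, rfl⟩
    rw [(hd t).deriv, omegaSt_eq_inner, hJ.sq, inner_neg_left, neg_eq_zero]
    have h := inner_grad_fderiv_eq_zero hG hfpos (by simpa using hsph t)
      (((hf.differentiable (by simp) _).sqrt (hfpos _ (hsph t)).ne').fun_smul differentiableAt_id)
      hv
    rwa [hΦγ] at h
  · rw [(hd t).deriv, lambdaSt, omegaSt_eq_inner, hJ.skew, hJ.sq, inner_neg_right, neg_neg,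
      real_inner_comm, hG.inner_grad_self, hlevel]
    norm_num
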